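/- arXiv:1808.04275 — 4 statements merged into one kernel-verified Lean document; each statement's English description precedes it below -/
import Mathlib

section
/- For every integer n ≥ 1, the number of symmetric Dellac configurations of size 2n satisfies |SDC_{2n}| = Σ_{T ∈ T_n^e} 2^{fr(T)}. -/
open scoped Classical

namespace SymDellac

/-- The polynomials `P n` (for `n ≥ 1`) defined by `P 1 = 1` and
`P (n+1) (x) = ((x+2)(x+1)/2) P n (x+2) - (x(x-1)/2) P n (x)`. -/
noncomputable def P : ℕ → Polynomial ℚ
  | 0 => 1
  | 1 => 1
  | n + 2 =>
      Polynomial.C (1/2 : ℚ) *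
        ((Polynomial.X + 2) * (Polynomial.X + 1) * ((P (n+1)).comp (Polynomial.X + 2))
          - Polynomial.X * (Polynomial.X - 1) * (P (n+1)))

/-- The polynomials `D n` defined by `D 0 = 1` and
`D (n+1) (x) = (x+1)(x+2) D n (x+2) - x(x+1) D n (x)`. -/
noncomputable def D : ℕ → Polynomial ℚ
  | 0 => 1
  | n + 1 =>
      (Polynomial.X + 1) * (Polynomial.X + 2) * ((D n).comp (Polynomial.X + 2))
        - Polynomial.X * (Polynomial.X + 1) * (D n)

/-! ### Even extended Dellac configurations -/

/-- `T` is an even extended Dellac configuration of size `n`. -/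
def IsTne (n : ℕ) (T : Finset (ℕ × ℕ)) : Prop :=
  (∀ p ∈ T, 1 ≤ p.1 ∧ p.1 ≤ n ∧ 1 ≤ p.2 ∧ p.2 ≤ 2*n ∧ p.1 ≤ p.2) ∧
  (∀ i ∈ Finset.Icc 1 (2*n), (T.filter (fun p => p.2 = i)).card = 1) ∧
  (∀ j ∈ Finset.Icc 1 n, (T.filter (fun p => p.1 = j)).card = 2)

/-- The finite set of even extended Dellac configurations of size `n`. -/
noncomputable def TneF (n : ℕ) : Finset (Finset (ℕ × ℕ)) :=
  ((Finset.Icc 1 n ×ˢ Finset.Icc 1 (2*n)).powerset).filter (IsTne n)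

/-- Number of free points of an even extended Dellac configuration. -/
def frE (n : ℕ) (T : Finset (ℕ × ℕ)) : ℕ :=
  (T.filter (fun p => 2*n + 1 ≤ p.2 + p.1)).card

/-- The (unique) point of `T` in row `r` (junk value if there is none). -/
noncomputable def rowPt (T : Finset (ℕ × ℕ)) (r : ℕ) : ℕ × ℕ :=
  if h : ∃ p ∈ T, p.2 = r then h.choose else (0, 0)

/-- `p` is the upper of the two points of its column in `T`. -/
def IsUpper (T : Finset (ℕ × ℕ)) (p : ℕ × ℕ) : Prop :=
  ∃ q ∈ T, q.1 = p.1 ∧ q.2 < p.2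

/-- One step of the path of Definition 1.2 (even case). -/
noncomputable def stepE (n : ℕ) (T : Finset (ℕ × ℕ)) (p : ℕ × ℕ) : ℕ × ℕ :=
  if p.1 = n then p
  else if IsUpper T p then rowPt T (2*n - p.1) else rowPt T p.1

/-- The path `(p_0, p_1, …)` starting at the point of row `i` (even case). -/
noncomputable def pathE (n : ℕ) (T : Finset (ℕ × ℕ)) (i k : ℕ) : ℕ × ℕ :=
  (stepE n T)^[k] (rowPt T i)

/-- The set of points of the subsequence `S_T(i)` of strict column records. -/
noncomputable def recSetE (n : ℕ) (T : Finset (ℕ × ℕ)) (i : ℕ) : Set (ℕ × ℕ) :=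
  {p | ∃ k, pathE n T i k = p ∧ ∀ k' < k, (pathE n T i k').1 < p.1}

/-- `b(T)`: `B(T) = S_T(n)` has `b(T) + 1` elements. -/
noncomputable def bStat (n : ℕ) (T : Finset (ℕ × ℕ)) : ℕ := (recSetE n T n).ncard - 1

/-- `r(T)`: `R(T) = S_T(2n)` has `r(T) + 1` elements. -/
noncomputable def rStat (n : ℕ) (T : Finset (ℕ × ℕ)) : ℕ := (recSetE n T (2*n)).ncard - 1

/-- Row of the upper point of column `c` of `T`. -/
noncomputable def upRow (T : Finset (ℕ × ℕ)) (c : ℕ) : ℕ := sSup {i | (c, i) ∈ T}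

/-- Row of the lower point of column `c` of `T`. -/
noncomputable def lowRow (T : Finset (ℕ × ℕ)) (c : ℕ) : ℕ := sInf {i | (c, i) ∈ T}

/-- One step of the root sequence `I_T(j,i)`, in a tableau with `R` rows. -/
noncomputable def rStep (R j : ℕ) (T : Finset (ℕ × ℕ)) (x : ℕ) : ℕ :=
  if (j ≤ x ∧ x ≤ R - j) ∨ x = R then x
  else if R - j + 1 ≤ x ∧ x ≤ R - 1 then upRow T (R - x)
  else lowRow T x

/-- `root_T(j,i)`: the eventual constant value of the sequence `I_T(j,i)`
(junk value `0` if the sequence is not eventually constant). -/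
noncomputable def rootVal (R j : ℕ) (T : Finset (ℕ × ℕ)) (i : ℕ) : ℕ :=
  if h : ∃ v, ∃ N, ∀ k ≥ N, (rStep R j T)^[k] i = v then h.choose else 0

/-- The set `G(T)` for an even extended Dellac configuration. -/
noncomputable def GsetE (n : ℕ) (T : Finset (ℕ × ℕ)) : Set (ℕ × ℕ) :=
  {p | p ∈ T ∧ 2*n + 1 ≤ p.2 + p.1 ∧
    (∃ q ∈ T, q.1 = p.1 ∧ q ≠ p ∧ q ∈ recSetE n T n) ∧ rootVal (2*n) p.1 T p.2 = p.1}

/-- `g(T) = |G(T)|`. -/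
noncomputable def gStat (n : ℕ) (T : Finset (ℕ × ℕ)) : ℕ := (GsetE n T).ncard

/-- `max(T) = b(T) + r(T) + g(T)`. -/
noncomputable def maxStat (n : ℕ) (T : Finset (ℕ × ℕ)) : ℕ :=
  bStat n T + rStat n T + gStat n T

/-! ### Odd extended Dellac configurations -/

/-- `T` is an odd extended Dellac configuration of size `n`. -/
def IsTno (n : ℕ) (T : Finset (ℕ × ℕ)) : Prop :=
  (∀ p ∈ T, 1 ≤ p.1 ∧ p.1 ≤ n ∧ 1 ≤ p.2 ∧ p.2 ≤ 2*n+1 ∧ p.1 ≤ p.2) ∧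
  (∀ i : ℕ, (T.filter (fun p => p.2 = i)).card ≤ 1) ∧
  (∀ i ∈ Finset.Icc 1 n, (T.filter (fun p => p.2 = i)).card = 1) ∧
  (∀ j ∈ Finset.Icc 1 n, (T.filter (fun p => p.1 = j)).card = 2)

/-- The finite set of odd extended Dellac configurations of size `n`. -/
noncomputable def TnoF (n : ℕ) : Finset (Finset (ℕ × ℕ)) :=
  ((Finset.Icc 1 n ×ˢ Finset.Icc 1 (2*n+1)).powerset).filter (IsTno n)

/-- Number of free points of an odd extended Dellac configuration. -/
def frO (n : ℕ) (T : Finset (ℕ × ℕ)) : ℕ :=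
  (T.filter (fun p => 2*n + 2 ≤ p.2 + p.1)).card

/-- One step of the path (odd case): if the required row is empty, stay put. -/
noncomputable def stepO (n : ℕ) (T : Finset (ℕ × ℕ)) (p : ℕ × ℕ) : ℕ × ℕ :=
  if p.1 = n then p
  else
    let r : ℕ := if IsUpper T p then 2*n + 1 - p.1 else p.1
    if ∃ q ∈ T, q.2 = r then rowPt T r else p

/-- The path `(p_0, p_1, …)` starting at the point of row `i` (odd case). -/
noncomputable def pathO (n : ℕ) (T : Finset (ℕ × ℕ)) (i k : ℕ) : ℕ × ℕ :=
  (stepO n T)^[k] (rowPt T i)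

/-- The set of points of `V(T) = S_T(2n+1)` (empty if row `2n+1` is empty). -/
noncomputable def Vset (n : ℕ) (T : Finset (ℕ × ℕ)) : Set (ℕ × ℕ) :=
  if ∃ p ∈ T, p.2 = 2*n + 1 then
    {p | ∃ k, pathO n T (2*n+1) k = p ∧ ∀ k' < k, (pathO n T (2*n+1) k').1 < p.1}
  else ∅

/-- `v(T)`: the number of elements of `V(T)`. -/
noncomputable def vStat (n : ℕ) (T : Finset (ℕ × ℕ)) : ℕ := (Vset n T).ncard

/-- The set `G(T)` for an odd extended Dellac configuration. -/
noncomputable def GsetO (n : ℕ) (T : Finset (ℕ × ℕ)) : Set (ℕ × ℕ) :=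
  {p | p ∈ T ∧ 2*n + 2 ≤ p.2 + p.1 ∧
    (∃ q ∈ T, q.1 = p.1 ∧ q ≠ p ∧ q ∈ Vset n T) ∧ rootVal (2*n+1) p.1 T p.2 = p.1}

/-- `g(T) = |G(T)|` (odd case). -/
noncomputable def gStatO (n : ℕ) (T : Finset (ℕ × ℕ)) : ℕ := (GsetO n T).ncard

/-! ### Dellac configurations and symmetric Dellac configurations -/

/-- `D` is a Dellac configuration of size `N`. -/
def IsDC (N : ℕ) (D : Finset (ℕ × ℕ)) : Prop :=
  (∀ p ∈ D, 1 ≤ p.1 ∧ p.1 ≤ N ∧ 1 ≤ p.2 ∧ p.2 ≤ 2*N ∧ p.1 ≤ p.2 ∧ p.2 ≤ N + p.1) ∧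
  (∀ i ∈ Finset.Icc 1 (2*N), (D.filter (fun p => p.2 = i)).card = 1) ∧
  (∀ j ∈ Finset.Icc 1 N, (D.filter (fun p => p.1 = j)).card = 2)

/-- `D` is a symmetric Dellac configuration of size `N`. -/
def IsSDC (N : ℕ) (D : Finset (ℕ × ℕ)) : Prop :=
  IsDC N D ∧ ∀ p ∈ D, (N + 1 - p.1, 2*N + 1 - p.2) ∈ D

/-- The finite set of symmetric Dellac configurations of size `N`. -/
noncomputable def SDCF (N : ℕ) : Finset (Finset (ℕ × ℕ)) :=
  ((Finset.Icc 1 N ×ˢ Finset.Icc 1 (2*N)).powerset).filter (IsSDC N)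

/-! ### Surjective pistols -/

/-- `p` encodes a surjective pistol of size `n`: position `k` stands for `k+1 ∈ {1,…,2n}`
and value `p k` stands for `(p k) + 1 ∈ {2,4,…,2n}`. -/
def IsSP (n : ℕ) (p : Fin (2*n) → Fin (2*n)) : Prop :=
  (∀ k, Even ((p k : ℕ) + 1) ∧ (k : ℕ) ≤ (p k : ℕ)) ∧
  (∀ m : Fin (2*n), Even ((m : ℕ) + 1) → ∃ k, p k = m)

/-- The finite set of surjective pistols of size `n`. -/
noncomputable def SPF (n : ℕ) : Finset (Fin (2*n) → Fin (2*n)) :=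
  Finset.univ.filter (IsSP n)

/-- `max(f)`: the number of `j ∈ {1,…,2n-2}` with `f(j) = 2n`. -/
noncomputable def maxP (n : ℕ) (p : Fin (2*n) → Fin (2*n)) : ℕ :=
  (Finset.univ.filter (fun k : Fin (2*n) => (k : ℕ) + 1 ≤ 2*n - 2 ∧ (p k : ℕ) + 1 = 2*n)).card

/-- `fd(f)`: the number of doubled fixed points of `f`. -/
noncomputable def fdP (n : ℕ) (p : Fin (2*n) → Fin (2*n)) : ℕ :=
  (Finset.univ.filter (fun k : Fin (2*n) =>
    (k : ℕ) + 1 ≤ 2*n - 2 ∧ (p k : ℕ) = (k : ℕ) ∧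
      ∃ k' : Fin (2*n), (k' : ℕ) < (k : ℕ) ∧ p k' = p k)).card

end SymDellac
/-! ### More constructions -/

namespace SymDellac

/-- `e_{n,k} = Σ_{T ∈ T_n^e, max(T) = k} 2^{fr(T) - 1 - k}`. -/
noncomputable def eStat (n k : ℕ) : ℕ :=
  ∑ T ∈ (TneF n).filter (fun T => maxStat n T = k), 2 ^ (frE n T - 1 - k)

/-- The configuration `T_{n,max}` with points `(j,j)` and `(j, 2n+1-j)` for `j ∈ [n]`. -/
def Tmax (n : ℕ) : Finset (ℕ × ℕ) :=
  (Finset.Icc 1 n).image (fun j => (j, j)) ∪ (Finset.Icc 1 n).image (fun j => (j, 2*n + 1 - j))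

/-- The index of the (unique) empty row of an odd extended Dellac configuration. -/
noncomputable def emptyRowIdx (n : ℕ) (T : Finset (ℕ × ℕ)) : ℕ :=
  sInf {i | 1 ≤ i ∧ i ≤ 2*n + 1 ∧ ∀ p ∈ T, p.2 ≠ i}

/-- The map `φ : T_n^o → T_n^e` deleting the empty row. -/
noncomputable def phi (n : ℕ) (T : Finset (ℕ × ℕ)) : Finset (ℕ × ℕ) :=
  T.image (fun p => if emptyRowIdx n T < p.2 then (p.1, p.2 - 1) else p)

/-- `Omax(T)`: the set of all points of `B(T)`, `R(T)` and `G(T)`. -/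
noncomputable def OmaxE (n : ℕ) (T : Finset (ℕ × ℕ)) : Set (ℕ × ℕ) :=
  recSetE n T n ∪ recSetE n T (2*n) ∪ GsetE n T

/-- Insertion of a point in the box `(j, r)` of a tableau `U` with `R` rows:
add the point `(j, i₀)` where `i₀` is the (unique) row with no point of `U`
in columns `1,…,j-1` whose root equals `r`. -/
noncomputable def insertPt (R j r : ℕ) (U : Finset (ℕ × ℕ)) : Finset (ℕ × ℕ) :=
  if h : ∃ i0, j ≤ i0 ∧ i0 ≤ R ∧ (∀ p ∈ U, p.2 = i0 → j ≤ p.1) ∧ rootVal R j U i0 = r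
  then insert (j, h.choose) U else U

/-- One step (column `j`) of the construction of `P(T)`. -/
noncomputable def Pstep (n : ℕ) (T : Finset (ℕ × ℕ)) (U : Finset (ℕ × ℕ)) (j : ℕ) :
    Finset (ℕ × ℕ) :=
  let U1 := if ∃ p ∈ T, p.1 = j ∧ p ∈ recSetE n T n ∪ recSetE n T (2*n)
    then insertPt (2*n - 1) j (2*n - 1) U else U
  if ∃ p ∈ T, p.1 = j ∧ p ∈ GsetE n T then insertPt (2*n - 1) j j U1 else U1

/-- The map `P : T_n^e → T_{n-1}^o`. -/
noncomputable def Pmap (n : ℕ) (T : Finset (ℕ × ℕ)) : Finset (ℕ × ℕ) :=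
  (List.range' 1 (n-1)).foldl (Pstep n T)
    ((T.filter (fun p => p ∉ OmaxE n T)).image
      (fun p => (p.1, if p.2 < n then p.2 else p.2 - 1)))

end SymDellac

namespace SymDellac

theorem card_filter_snd_eq_one_iff {D : Finset (ℕ × ℕ)} {i : ℕ} :
    (D.filter (fun p => p.2 = i)).card = 1 ↔
      (∃ j, (j, i) ∈ D) ∧ ∀ j j', (j, i) ∈ D → (j', i) ∈ D → j = j' := by
  rw [Finset.card_eq_one]
  constructor
  · rintro ⟨⟨a, b⟩, h⟩
    simp only [Finset.ext_iff, Finset.mem_filter, Finset.mem_singleton, Prod.forall,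
      Prod.mk.injEq] at h
    have hab := (h a b).2 ⟨rfl, rfl⟩
    grind
  · rintro ⟨⟨j, hj⟩, h⟩
    refine ⟨(j, i), ?_⟩
    ext ⟨a, b⟩
    simp only [Finset.mem_filter, Finset.mem_singleton, Prod.mk.injEq]
    grind

/-- Rows of the left half of a symmetric configuration, folded onto `1, …, 2 * n`. -/
noncomputable def fold (n : ℕ) (D : Finset (ℕ × ℕ)) : Finset (ℕ × ℕ) :=
  (Finset.Icc 1 n ×ˢ Finset.Icc 1 (2*n)).filter
    (fun p => p ∈ D ∨ (p.1, 4*n + 1 - p.2) ∈ D)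

/-- The points of `fold n D` that come from the upper half of `D`. -/
noncomputable def reflected (n : ℕ) (D : Finset (ℕ × ℕ)) : Finset (ℕ × ℕ) :=
  (Finset.Icc 1 n ×ˢ Finset.Icc 1 (2*n)).filter (fun p => (p.1, 4*n + 1 - p.2) ∈ D)

/-- The left half obtained from `T` by reflecting the points of `S` into the upper half. -/
def IsLeft (n : ℕ) (T S : Finset (ℕ × ℕ)) (j i : ℕ) : Prop :=
  ((j, i) ∈ T ∧ (j, i) ∉ S) ∨ (j, 4*n + 1 - i) ∈ S

/-- The symmetric configuration with left half `IsLeft n T S`. -/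
noncomputable def unfold (n : ℕ) (T S : Finset (ℕ × ℕ)) : Finset (ℕ × ℕ) :=
  (Finset.Icc 1 (2*n) ×ˢ Finset.Icc 1 (4*n)).filter
    (fun p => IsLeft n T S p.1 p.2 ∨ IsLeft n T S (2*n + 1 - p.1) (4*n + 1 - p.2))

theorem mem_fold {n j i : ℕ} {D : Finset (ℕ × ℕ)} :
    (j, i) ∈ fold n D ↔ (1 ≤ j ∧ j ≤ n ∧ 1 ≤ i ∧ i ≤ 2*n) ∧
      ((j, i) ∈ D ∨ (j, 4*n + 1 - i) ∈ D) := by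
  simp [fold, and_assoc]

theorem mem_reflected {n j i : ℕ} {D : Finset (ℕ × ℕ)} :
    (j, i) ∈ reflected n D ↔ (1 ≤ j ∧ j ≤ n ∧ 1 ≤ i ∧ i ≤ 2*n) ∧ (j, 4*n + 1 - i) ∈ D := by
  simp [reflected, and_assoc]

theorem mem_unfold {n j i : ℕ} {T S : Finset (ℕ × ℕ)} :
    (j, i) ∈ unfold n T S ↔ (1 ≤ j ∧ j ≤ 2*n ∧ 1 ≤ i ∧ i ≤ 4*n) ∧
      (IsLeft n T S j i ∨ IsLeft n T S (2*n + 1 - j) (4*n + 1 - i)) := by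
  simp [unfold, and_assoc]

theorem mem_TneF {n : ℕ} {T : Finset (ℕ × ℕ)} :
    T ∈ TneF n ↔
      (∀ j i, (j, i) ∈ T → 1 ≤ j ∧ j ≤ n ∧ 1 ≤ i ∧ i ≤ 2*n ∧ j ≤ i) ∧
      (∀ i, 1 ≤ i → i ≤ 2*n → ∃ j, (j, i) ∈ T) ∧
      (∀ i j j', (j, i) ∈ T → (j', i) ∈ T → j = j') ∧
      (∀ j, 1 ≤ j → j ≤ n → (T.filter (fun p => p.1 = j)).card = 2) := by
  simp only [TneF, IsTne, card_filter_snd_eq_one_iff, Finset.mem_filter, Finset.mem_powerset,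
    Finset.subset_iff, Finset.mem_product, Finset.mem_Icc, Prod.forall]
  grind

theorem mem_SDCF {n : ℕ} {D : Finset (ℕ × ℕ)} :
    D ∈ SDCF (2*n) ↔
      (∀ j i, (j, i) ∈ D → 1 ≤ j ∧ j ≤ 2*n ∧ 1 ≤ i ∧ i ≤ 4*n ∧ j ≤ i ∧ i ≤ 2*n + j) ∧
      (∀ i, 1 ≤ i → i ≤ 4*n → ∃ j, (j, i) ∈ D) ∧
      (∀ i j j', (j, i) ∈ D → (j', i) ∈ D → j = j') ∧
      (∀ j, 1 ≤ j → j ≤ 2*n → (D.filter (fun p => p.1 = j)).card = 2) ∧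
      (∀ j i, (j, i) ∈ D → (2*n + 1 - j, 4*n + 1 - i) ∈ D) := by
  have h4 : 2 * (2 * n) = 4 * n := by ring
  simp only [SDCF, IsSDC, IsDC, card_filter_snd_eq_one_iff, Finset.mem_filter,
    Finset.mem_powerset, Finset.subset_iff, Finset.mem_product, Finset.mem_Icc, Prod.forall, h4]
  grind

theorem not_mem_reflection {n j i : ℕ} {D : Finset (ℕ × ℕ)} (hD : D ∈ SDCF (2*n))
    (h : (j, i) ∈ D) : (j, 4*n + 1 - i) ∉ D := by
  obtain ⟨hb, -, hu, -, hs⟩ := mem_SDCF.1 hD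
  intro h'
  have h1 := hs _ _ h'
  have h2 := hb _ _ h
  rw [show 4*n + 1 - (4*n + 1 - i) = i by omega] at h1
  have := hu _ _ _ h h1
  omega

theorem fold_mem_TneF {n : ℕ} {D : Finset (ℕ × ℕ)} (hD : D ∈ SDCF (2*n)) :
    fold n D ∈ TneF n := by
  obtain ⟨hb, he, hu, hc, hs⟩ := mem_SDCF.1 hD
  refine mem_TneF.2 ⟨?_, ?_, ?_, ?_⟩
  · intro j i h
    rw [mem_fold] at h
    obtain ⟨h1, h | h⟩ := h <;> have := hb _ _ h <;> omega
  · intro i hi hi'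
    obtain ⟨j, hj⟩ := he i hi (by omega)
    have := hb _ _ hj
    by_cases hjn : j ≤ n
    · exact ⟨j, mem_fold.2 ⟨by omega, Or.inl hj⟩⟩
    · exact ⟨2*n + 1 - j, mem_fold.2 ⟨by omega, Or.inr (hs _ _ hj)⟩⟩
  · intro i j j' h h'
    rw [mem_fold] at h h'
    obtain ⟨hbj, h⟩ := h
    obtain ⟨hbj', h'⟩ := h'
    have key : ∀ a b, a ≤ n → b ≤ n → i ≤ 2*n → (a, i) ∈ D → (b, 4*n + 1 - i) ∉ D := by
      intro a b ha hb' hi h1 h2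
      have h3 := hs _ _ h2
      rw [show 4*n + 1 - (4*n + 1 - i) = i by omega] at h3
      have := hu _ _ _ h1 h3
      have := hb _ _ h1
      omega
    obtain h | h := h <;> obtain h' | h' := h'
    · exact hu _ _ _ h h'
    · exact absurd h' (key _ _ (by omega) (by omega) (by omega) h)
    · exact absurd h (key _ _ (by omega) (by omega) (by omega) h')
    · exact hu _ _ _ h h'
  · intro j hj hjn
    rw [← hc j hj (by omega)]
    refine Finset.card_nbij' (fun p => if p ∈ D then p else (p.1, 4*n + 1 - p.2))
      (fun p => if p.2 ≤ 2*n then p else (p.1, 4*n + 1 - p.2)) ?_ ?_ ?_ ?_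
    all_goals
      rintro ⟨a, i⟩ h
      simp only [Finset.coe_filter, Set.mem_ofPred_eq, mem_fold] at h ⊢
      obtain ⟨h, rfl⟩ := h
    · grind
    · have := hb _ _ h
      have h' : 4*n + 1 - (4*n + 1 - i) = i := by omega
      split_ifs with hi
      · exact ⟨mem_fold.2 ⟨by omega, Or.inl h⟩, rfl⟩
      · exact ⟨mem_fold.2 ⟨by omega, Or.inr (by rwa [h'])⟩, rfl⟩
    · have h' : 4*n + 1 - (4*n + 1 - i) = i := by omega
      grind
    · have := hb _ _ h
      have h' : 4*n + 1 - (4*n + 1 - i) = i := by omega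
      have := not_mem_reflection hD h
      grind

theorem reflected_subset {n : ℕ} {D : Finset (ℕ × ℕ)} (hD : D ∈ SDCF (2*n)) :
    reflected n D ⊆ (fold n D).filter (fun p => 2*n + 1 ≤ p.2 + p.1) := by
  rintro ⟨j, i⟩ h
  rw [mem_reflected] at h
  have := (mem_SDCF.1 hD).1 _ _ h.2
  exact Finset.mem_filter.2 ⟨mem_fold.2 ⟨h.1, Or.inr h.2⟩, by dsimp only; omega⟩

section Unfold

variable {n : ℕ} {T S : Finset (ℕ × ℕ)}

theorem mem_of_mem_free (hS : S ⊆ T.filter (fun p => 2*n + 1 ≤ p.2 + p.1)) {j i : ℕ}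
    (h : (j, i) ∈ S) : (j, i) ∈ T ∧ 2*n + 1 ≤ i + j := by
  simpa using hS h

theorem IsLeft.bounds (hT : T ∈ TneF n) (hS : S ⊆ T.filter (fun p => 2*n + 1 ≤ p.2 + p.1))
    {j i : ℕ} (h : IsLeft n T S j i) :
    1 ≤ j ∧ j ≤ n ∧ 1 ≤ i ∧ i ≤ 4*n ∧ j ≤ i ∧ i ≤ 2*n + j := by
  obtain ⟨hb, -⟩ := mem_TneF.1 hT
  obtain ⟨h, -⟩ | h := h
  · have := hb _ _ h
    omega
  · obtain ⟨h1, h2⟩ := mem_of_mem_free hS h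
    have := hb _ _ h1
    omega

theorem IsLeft.mem_of_le (hT : T ∈ TneF n)
    (hS : S ⊆ T.filter (fun p => 2*n + 1 ≤ p.2 + p.1))
    {j i : ℕ} (h : IsLeft n T S j i) (hi : i ≤ 2*n) : (j, i) ∈ T ∧ (j, i) ∉ S := by
  obtain h | h := h
  · exact h
  · have := (mem_TneF.1 hT).1 _ _ (mem_of_mem_free hS h).1
    omega

theorem IsLeft.mem_of_lt (hT : T ∈ TneF n) {j i : ℕ} (h : IsLeft n T S j i) (hi : 2*n < i) :
    (j, 4*n + 1 - i) ∈ S := by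
  obtain h | h := h
  · have := (mem_TneF.1 hT).1 _ _ h.1
    omega
  · exact h

theorem IsLeft.unique (hT : T ∈ TneF n) (hS : S ⊆ T.filter (fun p => 2*n + 1 ≤ p.2 + p.1))
    {j j' i : ℕ} (h : IsLeft n T S j i) (h' : IsLeft n T S j' i) : j = j' := by
  obtain ⟨-, -, hu, -⟩ := mem_TneF.1 hT
  obtain hi | hi := le_or_gt i (2*n)
  · exact hu _ _ _ (h.mem_of_le hT hS hi).1 (h'.mem_of_le hT hS hi).1
  · exact hu _ _ _ (mem_of_mem_free hS (h.mem_of_lt hT hi)).1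
      (mem_of_mem_free hS (h'.mem_of_lt hT hi)).1

theorem IsLeft.not_reflection (hT : T ∈ TneF n)
    (hS : S ⊆ T.filter (fun p => 2*n + 1 ≤ p.2 + p.1))
    {j j' i : ℕ} (h : IsLeft n T S j i) : ¬ IsLeft n T S j' (4*n + 1 - i) := by
  intro h'
  obtain ⟨-, -, hu, -⟩ := mem_TneF.1 hT
  have hb := h.bounds hT hS
  have hr : 4*n + 1 - (4*n + 1 - i) = i := by omega
  obtain hi | hi := le_or_gt i (2*n)
  · have h1 := h.mem_of_le hT hS hi
    have h2 := h'.mem_of_lt hT (by omega)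
    rw [hr] at h2
    obtain rfl := hu _ _ _ h1.1 (mem_of_mem_free hS h2).1
    exact h1.2 h2
  · have h1 := h.mem_of_lt hT hi
    have h2 := h'.mem_of_le hT hS (by omega)
    obtain rfl := hu _ _ _ h2.1 (mem_of_mem_free hS h1).1
    exact h2.2 h1

theorem mem_unfold_of_le (hT : T ∈ TneF n)
    (hS : S ⊆ T.filter (fun p => 2*n + 1 ≤ p.2 + p.1)) {j i : ℕ} (hj : j ≤ n) :
    (j, i) ∈ unfold n T S ↔ IsLeft n T S j i := by
  rw [mem_unfold]
  constructor
  · rintro ⟨hb, h | h⟩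
    · exact h
    · have := h.bounds hT hS
      omega
  · intro h
    have := h.bounds hT hS
    exact ⟨by omega, Or.inl h⟩

theorem rotation_mem_unfold {j i : ℕ} (h : (j, i) ∈ unfold n T S) :
    (2*n + 1 - j, 4*n + 1 - i) ∈ unfold n T S := by
  rw [mem_unfold] at h ⊢
  obtain ⟨hb, h⟩ := h
  rw [show 2*n + 1 - (2*n + 1 - j) = j by omega, show 4*n + 1 - (4*n + 1 - i) = i by omega]
  exact ⟨by omega, h.symm⟩

theorem card_unfold_column_of_le (hT : T ∈ TneF n)
    (hS : S ⊆ T.filter (fun p => 2*n + 1 ≤ p.2 + p.1)) {j : ℕ} (hj : 1 ≤ j) (hjn : j ≤ n) :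
    ((unfold n T S).filter (fun p => p.1 = j)).card = 2 := by
  obtain ⟨hb, -, -, hc⟩ := mem_TneF.1 hT
  rw [← hc j hj hjn]
  refine Finset.card_nbij' (fun p => if p.2 ≤ 2*n then p else (p.1, 4*n + 1 - p.2))
    (fun p => if p ∈ S then (p.1, 4*n + 1 - p.2) else p) ?_ ?_ ?_ ?_
  · rintro ⟨a, i⟩ h
    simp only [Finset.coe_filter, Set.mem_ofPred_eq] at h ⊢
    obtain ⟨h, rfl⟩ := h
    rw [mem_unfold_of_le hT hS hjn] at h
    split_ifs with hi
    · exact ⟨(h.mem_of_le hT hS hi).1, rfl⟩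
    · exact ⟨(mem_of_mem_free hS (h.mem_of_lt hT (not_le.1 hi))).1, rfl⟩
  · rintro ⟨a, i⟩ h
    simp only [Finset.coe_filter, Set.mem_ofPred_eq] at h ⊢
    obtain ⟨h, rfl⟩ := h
    have := hb _ _ h
    split_ifs with hi
    · refine ⟨(mem_unfold_of_le hT hS hjn).2 (Or.inr ?_), rfl⟩
      rwa [show 4*n + 1 - (4*n + 1 - i) = i by omega]
    · exact ⟨(mem_unfold_of_le hT hS hjn).2 (Or.inl ⟨h, hi⟩), rfl⟩
  · rintro ⟨a, i⟩ h
    simp only [Finset.coe_filter, Set.mem_ofPred_eq] at h ⊢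
    obtain ⟨h, rfl⟩ := h
    rw [mem_unfold_of_le hT hS hjn] at h
    have := h.bounds hT hS
    have hr : 4*n + 1 - (4*n + 1 - i) = i := by omega
    by_cases hi : i ≤ 2*n
    · simp [hi, (h.mem_of_le hT hS hi).2]
    · simp [hi, h.mem_of_lt hT (not_le.1 hi), hr]
  · rintro ⟨a, i⟩ h
    simp only [Finset.coe_filter, Set.mem_ofPred_eq] at h ⊢
    have := hb _ _ h.1
    have hr : 4*n + 1 - (4*n + 1 - i) = i := by omega
    grind

theorem unfold_mem_SDCF (hT : T ∈ TneF n)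
    (hS : S ⊆ T.filter (fun p => 2*n + 1 ≤ p.2 + p.1)) : unfold n T S ∈ SDCF (2*n) := by
  obtain ⟨hb, he, hu, hc⟩ := mem_TneF.1 hT
  refine mem_SDCF.2 ⟨?_, ?_, ?_, ?_, fun _ _ => rotation_mem_unfold⟩
  · intro j i h
    rw [mem_unfold] at h
    obtain ⟨h1, h | h⟩ := h <;> have := h.bounds hT hS <;> omega
  · have key : ∀ i, 1 ≤ i → i ≤ 2*n →
        ∃ j, IsLeft n T S j i ∨ IsLeft n T S j (4*n + 1 - i) := by
      intro i hi hi'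
      obtain ⟨j, hj⟩ := he i hi hi'
      by_cases hjS : (j, i) ∈ S
      · exact ⟨j, Or.inr (Or.inr (by rwa [show 4*n + 1 - (4*n + 1 - i) = i by omega]))⟩
      · exact ⟨j, Or.inl (Or.inl ⟨hj, hjS⟩)⟩
    have lift : ∀ i j, 1 ≤ i → i ≤ 4*n → IsLeft n T S j i ∨ IsLeft n T S j (4*n + 1 - i) →
        ∃ j, (j, i) ∈ unfold n T S := by
      rintro i j hi hi' (h | h)
      · have := h.bounds hT hS
        exact ⟨j, (mem_unfold_of_le hT hS (by omega)).2 h⟩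
      · have := h.bounds hT hS
        have h' := rotation_mem_unfold ((mem_unfold_of_le hT hS (by omega)).2 h)
        rw [show 4*n + 1 - (4*n + 1 - i) = i by omega] at h'
        exact ⟨_, h'⟩
    intro i hi hi'
    by_cases hin : i ≤ 2*n
    · obtain ⟨j, hj⟩ := key i hi hin
      exact lift i j hi hi' hj
    · obtain ⟨j, hj⟩ := key (4*n + 1 - i) (by omega) (by omega)
      rw [show 4*n + 1 - (4*n + 1 - i) = i by omega] at hj
      exact lift i j hi hi' hj.symm
  · intro i j j' h h'
    rw [mem_unfold] at h h'
    obtain ⟨h1, h⟩ := h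
    obtain ⟨h2, h'⟩ := h'
    obtain h | h := h <;> obtain h' | h' := h'
    · exact h.unique hT hS h'
    · exact absurd h' (h.not_reflection hT hS)
    · exact absurd h (h'.not_reflection hT hS)
    · have := h.unique hT hS h'
      omega
  · intro j hj hj'
    by_cases hjn : j ≤ n
    · exact card_unfold_column_of_le hT hS hj hjn
    · rw [← card_unfold_column_of_le hT hS (j := 2*n + 1 - j) (by omega) (by omega)]
      refine Finset.card_nbij' (fun p => (2*n + 1 - p.1, 4*n + 1 - p.2))
        (fun p => (2*n + 1 - p.1, 4*n + 1 - p.2)) ?_ ?_ ?_ ?_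
      all_goals
        rintro ⟨a, i⟩ h
        simp only [Finset.coe_filter, Set.mem_ofPred_eq, Prod.mk.injEq] at h ⊢
        have hm := (mem_unfold.1 h.1).1
      · exact ⟨rotation_mem_unfold h.1, by omega⟩
      · exact ⟨rotation_mem_unfold h.1, by omega⟩
      · omega
      · omega

theorem fold_unfold (hT : T ∈ TneF n)
    (hS : S ⊆ T.filter (fun p => 2*n + 1 ≤ p.2 + p.1)) : fold n (unfold n T S) = T := by
  ext ⟨j, i⟩
  rw [mem_fold]
  constructor
  · rintro ⟨hb, h⟩
    rw [mem_unfold_of_le hT hS (by omega), mem_unfold_of_le hT hS (by omega)] at h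
    obtain h | h := h
    · exact (h.mem_of_le hT hS (by omega)).1
    · have := h.mem_of_lt hT (by omega)
      rw [show 4*n + 1 - (4*n + 1 - i) = i by omega] at this
      exact (mem_of_mem_free hS this).1
  · intro h
    have := (mem_TneF.1 hT).1 _ _ h
    rw [mem_unfold_of_le hT hS (by omega), mem_unfold_of_le hT hS (by omega)]
    refine ⟨by omega, ?_⟩
    by_cases hjS : (j, i) ∈ S
    · exact Or.inr (Or.inr (by rwa [show 4*n + 1 - (4*n + 1 - i) = i by omega]))
    · exact Or.inl (Or.inl ⟨h, hjS⟩)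

theorem reflected_unfold (hT : T ∈ TneF n)
    (hS : S ⊆ T.filter (fun p => 2*n + 1 ≤ p.2 + p.1)) : reflected n (unfold n T S) = S := by
  ext ⟨j, i⟩
  rw [mem_reflected]
  constructor
  · rintro ⟨hb, h⟩
    rw [mem_unfold_of_le hT hS (by omega)] at h
    have := h.mem_of_lt hT (by omega)
    rwa [show 4*n + 1 - (4*n + 1 - i) = i by omega] at this
  · intro h
    have := (mem_TneF.1 hT).1 _ _ (mem_of_mem_free hS h).1
    rw [mem_unfold_of_le hT hS (by omega)]
    exact ⟨by omega, Or.inr (by rwa [show 4*n + 1 - (4*n + 1 - i) = i by omega])⟩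

end Unfold

theorem isLeft_fold_reflected {n : ℕ} {D : Finset (ℕ × ℕ)} (hD : D ∈ SDCF (2*n)) {j i : ℕ}
    (hj : j ≤ n) : IsLeft n (fold n D) (reflected n D) j i ↔ (j, i) ∈ D := by
  have hb := (mem_SDCF.1 hD).1
  rw [IsLeft, mem_fold, mem_reflected, mem_reflected]
  constructor
  · rintro (⟨⟨h1, h | h⟩, h2⟩ | ⟨h1, h⟩)
    · exact h
    · exact absurd ⟨h1, h⟩ h2
    · rwa [show 4*n + 1 - (4*n + 1 - i) = i by omega] at h
  · intro h
    have := hb _ _ h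
    by_cases hi : i ≤ 2*n
    · exact Or.inl ⟨⟨by omega, Or.inl h⟩, fun h' => not_mem_reflection hD h h'.2⟩
    · exact Or.inr ⟨by omega, by rwa [show 4*n + 1 - (4*n + 1 - i) = i by omega]⟩

theorem unfold_fold {n : ℕ} {D : Finset (ℕ × ℕ)} (hD : D ∈ SDCF (2*n)) :
    unfold n (fold n D) (reflected n D) = D := by
  obtain ⟨hb, -, -, -, hs⟩ := mem_SDCF.1 hD
  have left : ∀ j i, j ≤ n → ((j, i) ∈ unfold n (fold n D) (reflected n D) ↔ (j, i) ∈ D) :=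
    fun j i hj => by
      rw [mem_unfold_of_le (fold_mem_TneF hD) (reflected_subset hD) hj,
        isLeft_fold_reflected hD hj]
  ext ⟨j, i⟩
  by_cases hj : j ≤ n
  · exact left j i hj
  constructor
  · intro h
    have := (mem_unfold.1 h).1
    have h' := hs _ _ ((left _ _ (by omega)).1 (rotation_mem_unfold h))
    rwa [show 2*n + 1 - (2*n + 1 - j) = j by omega,
      show 4*n + 1 - (4*n + 1 - i) = i by omega] at h'
  · intro h
    have := hb _ _ h
    have h' := rotation_mem_unfold ((left _ _ (by omega)).2 (hs _ _ h))
    rwa [show 2*n + 1 - (2*n + 1 - j) = j by omega,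
      show 4*n + 1 - (4*n + 1 - i) = i by omega] at h'

/-- **Formula (4).** `|SDC_{2n}| = Σ_{T ∈ T_n^e} 2^{fr(T)}`. -/
theorem statement2 (n : ℕ) (hn : 1 ≤ n) :
    (SDCF (2*n)).card = ∑ T ∈ TneF n, 2 ^ (frE n T) := by
  have hcard : ∀ T ∈ TneF n,
      2 ^ frE n T = ((T.filter (fun p => 2*n + 1 ≤ p.2 + p.1)).powerset).card :=
    fun T _ => (Finset.card_powerset _).symm
  rw [Finset.sum_congr rfl hcard, ← Finset.card_sigma]
  refine Finset.card_bij' (fun D _ => ⟨fold n D, reflected n D⟩)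
    (fun x _ => unfold n x.1 x.2) ?_ ?_ ?_ ?_
  · intro D hD
    exact Finset.mem_sigma.2
      ⟨fold_mem_TneF hD, Finset.mem_powerset.2 (reflected_subset hD)⟩
  · rintro ⟨T, S⟩ h
    obtain ⟨hT, hS⟩ := Finset.mem_sigma.1 h
    exact unfold_mem_SDCF hT (Finset.mem_powerset.1 hS)
  · intro D hD
    exact unfold_fold hD
  · rintro ⟨T, S⟩ h
    obtain ⟨hT, hS⟩ := Finset.mem_sigma.1 h
    have hS := Finset.mem_powerset.1 hS
    simp only [fold_unfold hT hS, reflected_unfold hT hS]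

end SymDellac
end

section
/- For every integer n ≥ 1, the number of symmetric Dellac configurations of size 2n+1 satisfies |SDC_{2n+1}| = Σ_{T ∈ T_n^o} 2^{fr(T)}. -/
open scoped Classical

namespace SymDellac

theorem card_row_eq_one_iff (T : Finset (ℕ × ℕ)) (i : ℕ) :
    (T.filter (fun p => p.2 = i)).card = 1 ↔ ∃ j, (j, i) ∈ T ∧ ∀ k, (k, i) ∈ T → k = j := by
  rw [Finset.card_eq_one]
  constructor
  · rintro ⟨⟨j, r⟩, h⟩
    have h' : ∀ a b, ((a, b) ∈ T ∧ b = i) ↔ (a = j ∧ b = r) := by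
      intro a b
      simpa using Finset.ext_iff.1 h (a, b)
    obtain ⟨h1, rfl⟩ := (h' j r).2 ⟨rfl, rfl⟩
    exact ⟨j, h1, fun k hk => ((h' k r).1 ⟨hk, rfl⟩).1⟩
  · rintro ⟨j, hj, h⟩
    refine ⟨(j, i), ?_⟩
    ext ⟨a, b⟩
    simp only [Finset.mem_filter, Finset.mem_singleton, Prod.mk.injEq]
    constructor
    · rintro ⟨h1, rfl⟩
      exact ⟨h a h1, rfl⟩
    · rintro ⟨rfl, rfl⟩
      exact ⟨hj, rfl⟩

theorem card_row_le_one_iff (T : Finset (ℕ × ℕ)) (i : ℕ) :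
    (T.filter (fun p => p.2 = i)).card ≤ 1 ↔ ∀ j k, (j, i) ∈ T → (k, i) ∈ T → j = k := by
  rw [Finset.card_le_one]
  constructor
  · intro h j k hj hk
    simpa using h (j, i) (by simp [hj]) (k, i) (by simp [hk])
  · rintro h ⟨a, b⟩ hab ⟨c, d⟩ hcd
    simp only [Finset.mem_filter] at hab hcd
    obtain ⟨h1, rfl⟩ := hab
    obtain ⟨h2, rfl⟩ := hcd
    rw [h a c h1 h2]

/-- The left half of `D`, with its rows above `2n+1` reflected onto the rows below. -/
noncomputable def foldConf (n : ℕ) (D : Finset (ℕ × ℕ)) : Finset (ℕ × ℕ) :=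
  (Finset.Icc 1 n ×ˢ Finset.Icc 1 (2*n+1)).filter
    (fun p => p ∈ D ∨ (p.1, 4*n+3 - p.2) ∈ D)

/-- The points of `foldConf n D` which come from a reflected row. -/
noncomputable def flippedPts (n : ℕ) (D : Finset (ℕ × ℕ)) : Finset (ℕ × ℕ) :=
  (Finset.Icc 1 n ×ˢ Finset.Icc 1 (2*n+1)).filter (fun p => (p.1, 4*n+3 - p.2) ∈ D)

/-- The symmetric configuration of size `2n+1` obtained from `T` by reflecting the rows of
the points of `S`, filling the middle column with the empty rows, and symmetrizing. -/
noncomputable def unfoldConf (n : ℕ) (T S : Finset (ℕ × ℕ)) : Finset (ℕ × ℕ) :=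
  (Finset.Icc 1 (2*n+1) ×ˢ Finset.Icc 1 (4*n+2)).filter (fun p =>
    (p.1 ≤ n ∧ ((p ∈ T ∧ p ∉ S) ∨ (p.1, 4*n+3 - p.2) ∈ S)) ∨
    (p.1 = n+1 ∧ ∀ j, (j, p.2) ∉ T ∧ (j, 4*n+3 - p.2) ∉ T) ∨
    (n+2 ≤ p.1 ∧ (((2*n+2 - p.1, 4*n+3 - p.2) ∈ T ∧ (2*n+2 - p.1, 4*n+3 - p.2) ∉ S) ∨
      (2*n+2 - p.1, p.2) ∈ S)))

theorem mem_foldConf {n : ℕ} {D : Finset (ℕ × ℕ)} {j i : ℕ} :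
    (j, i) ∈ foldConf n D ↔ (1 ≤ j ∧ j ≤ n ∧ 1 ≤ i ∧ i ≤ 2*n+1) ∧
      ((j, i) ∈ D ∨ (j, 4*n+3 - i) ∈ D) := by
  simp [foldConf, and_assoc]

theorem mem_flippedPts {n : ℕ} {D : Finset (ℕ × ℕ)} {j i : ℕ} :
    (j, i) ∈ flippedPts n D ↔ (1 ≤ j ∧ j ≤ n ∧ 1 ≤ i ∧ i ≤ 2*n+1) ∧ (j, 4*n+3 - i) ∈ D := by
  simp [flippedPts, and_assoc]

theorem mem_unfoldConf {n : ℕ} {T S : Finset (ℕ × ℕ)} {j i : ℕ} :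
    (j, i) ∈ unfoldConf n T S ↔ (1 ≤ j ∧ j ≤ 2*n+1 ∧ 1 ≤ i ∧ i ≤ 4*n+2) ∧
    ((j ≤ n ∧ (((j, i) ∈ T ∧ (j, i) ∉ S) ∨ (j, 4*n+3 - i) ∈ S)) ∨
    (j = n+1 ∧ ∀ k, (k, i) ∉ T ∧ (k, 4*n+3 - i) ∉ T) ∨
    (n+2 ≤ j ∧ (((2*n+2 - j, 4*n+3 - i) ∈ T ∧ (2*n+2 - j, 4*n+3 - i) ∉ S) ∨
      (2*n+2 - j, i) ∈ S))) := by
  simp [unfoldConf, and_assoc]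

theorem mem_TnoF_iff {n : ℕ} {T : Finset (ℕ × ℕ)} : T ∈ TnoF n ↔
    (∀ j i, (j, i) ∈ T → 1 ≤ j ∧ j ≤ n ∧ 1 ≤ i ∧ i ≤ 2*n+1 ∧ j ≤ i) ∧
    (∀ i j k, (j, i) ∈ T → (k, i) ∈ T → j = k) ∧
    (∀ i, 1 ≤ i → i ≤ n → ∃ j, (j, i) ∈ T) ∧
    (∀ j ∈ Finset.Icc 1 n, (T.filter (fun p => p.1 = j)).card = 2) := by
  simp only [TnoF, Finset.mem_filter, Finset.mem_powerset, IsTno, card_row_eq_one_iff,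
    card_row_le_one_iff, Prod.forall]
  constructor
  · rintro ⟨-, h1, h2, h3, h4⟩
    refine ⟨h1, h2, fun i hi hi' => ?_, h4⟩
    obtain ⟨j, hj, -⟩ := h3 i (Finset.mem_Icc.2 ⟨hi, hi'⟩)
    exact ⟨j, hj⟩
  · rintro ⟨h1, h2, h3, h4⟩
    refine ⟨?_, h1, h2, fun i hi => ?_, h4⟩
    · rintro ⟨j, i⟩ h
      have := h1 j i h
      simp only [Finset.mem_product, Finset.mem_Icc]
      omega
    · rw [Finset.mem_Icc] at hi
      obtain ⟨j, hj⟩ := h3 i hi.1 hi.2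
      exact ⟨j, hj, fun k hk => h2 i k j hk hj⟩

theorem mem_SDCF_iff {n : ℕ} {D : Finset (ℕ × ℕ)} : D ∈ SDCF (2*n+1) ↔
    (∀ j i, (j, i) ∈ D → 1 ≤ j ∧ j ≤ 2*n+1 ∧ 1 ≤ i ∧ i ≤ 4*n+2 ∧ j ≤ i ∧ i ≤ 2*n+1+j) ∧
    (∀ i j k, (j, i) ∈ D → (k, i) ∈ D → j = k) ∧
    (∀ i, 1 ≤ i → i ≤ 4*n+2 → ∃ j, (j, i) ∈ D) ∧
    (∀ j ∈ Finset.Icc 1 (2*n+1), (D.filter (fun p => p.1 = j)).card = 2) ∧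
    (∀ j i, (j, i) ∈ D → (2*n+2 - j, 4*n+3 - i) ∈ D) := by
  have e1 : 2 * (2*n+1) = 4*n+2 := by ring
  simp only [SDCF, Finset.mem_filter, Finset.mem_powerset, IsSDC, IsDC, card_row_eq_one_iff,
    Prod.forall, e1]
  constructor
  · rintro ⟨-, ⟨h1, h3, h4⟩, h5⟩
    refine ⟨h1, fun i j k hj hk => ?_, fun i hi hi' => ?_, h4, h5⟩
    · have := h1 j i hj
      obtain ⟨l, -, hl⟩ := h3 i (by rw [Finset.mem_Icc]; omega)
      rw [hl j hj, hl k hk]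
    · obtain ⟨j, hj, -⟩ := h3 i (Finset.mem_Icc.2 ⟨hi, hi'⟩)
      exact ⟨j, hj⟩
  · rintro ⟨h1, h2, h3, h4, h5⟩
    refine ⟨?_, ⟨h1, fun i hi => ?_, h4⟩, h5⟩
    · rintro ⟨j, i⟩ h
      have := h1 j i h
      simp only [Finset.mem_product, Finset.mem_Icc]
      omega
    · rw [Finset.mem_Icc] at hi
      obtain ⟨j, hj⟩ := h3 i hi.1 hi.2
      exact ⟨j, hj, fun k hk => h2 i k j hk hj⟩

/-- Reflecting the rows of some points of a column of `T` does not change its cardinality. -/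
theorem card_col_eq {n : ℕ} {D T S : Finset (ℕ × ℕ)} (hST : S ⊆ T)
    (hT0 : ∀ j i, (j, i) ∈ T → 1 ≤ i) (hT : ∀ j i, (j, i) ∈ T → i ≤ 2*n+1) {j : ℕ}
    (h : ∀ i, (j, i) ∈ D ↔ i ≤ 4*n+2 ∧ (((j, i) ∈ T ∧ (j, i) ∉ S) ∨ (j, 4*n+3 - i) ∈ S)) :
    (D.filter (fun p => p.1 = j)).card = (T.filter (fun p => p.1 = j)).card := by
  symm
  apply Finset.card_nbij (fun p => if p ∈ S then (p.1, 4*n+3 - p.2) else p)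
  · rintro ⟨a, b⟩ hab
    simp only [Finset.mem_coe, Finset.mem_filter] at hab ⊢
    obtain ⟨hab, rfl⟩ := hab
    have := hT _ _ hab
    split_ifs with hs
    · have e : 4*n+3 - (4*n+3 - b) = b := by omega
      refine ⟨(h _).2 ⟨?_, Or.inr (by rwa [e])⟩, rfl⟩
      have := hT0 _ _ hab
      omega
    · exact ⟨(h _).2 ⟨by omega, Or.inl ⟨hab, hs⟩⟩, rfl⟩
  · rintro ⟨a, b⟩ hab ⟨c, d⟩ hcd
    simp only [Finset.mem_coe, Finset.mem_filter] at hab hcd ⊢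
    have := hT _ _ hab.1
    have := hT _ _ hcd.1
    split_ifs <;> simp only [Prod.mk.injEq] <;> omega
  · rintro ⟨a, b⟩ hab
    simp only [Finset.mem_coe, Finset.mem_filter] at hab
    obtain ⟨hab, rfl⟩ := hab
    rw [h] at hab
    simp only [Set.mem_image, Finset.mem_coe, Finset.mem_filter]
    rcases hab with ⟨hb, ⟨h1, h2⟩ | h1⟩
    · exact ⟨(a, b), ⟨h1, rfl⟩, by simp [h2]⟩
    · refine ⟨(a, 4*n+3 - b), ⟨hST h1, rfl⟩, ?_⟩
      simp only [h1, if_true, Prod.mk.injEq, true_and]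
      omega

theorem exists_unique_empty_row {n : ℕ} {T : Finset (ℕ × ℕ)} (hT : T ∈ TnoF n) :
    ∃ e, n+1 ≤ e ∧ e ≤ 2*n+1 ∧
      ∀ i, 1 ≤ i → i ≤ 2*n+1 → ((∀ j, (j, i) ∉ T) ↔ i = e) := by
  obtain ⟨h1, h2, h3, h4⟩ := mem_TnoF_iff.1 hT
  have hc : T.card = 2*n := by
    rw [Finset.card_eq_sum_card_fiberwise (f := Prod.fst) (t := Finset.Icc 1 n),
      Finset.sum_congr rfl h4]
    · simp [mul_comm]
    · rintro ⟨j, i⟩ h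
      have := h1 j i h
      simp only [Finset.coe_Icc, Set.mem_Icc]
      omega
  have hi : (T.image Prod.snd).card = 2*n := by
    rw [Finset.card_image_of_injOn, hc]
    rintro ⟨a, b⟩ hab ⟨c, d⟩ hcd hbd
    obtain rfl : b = d := hbd
    rw [h2 b a c hab hcd]
  have hsub : T.image Prod.snd ⊆ Finset.Icc 1 (2*n+1) := by
    intro i hi
    obtain ⟨⟨j, i⟩, h, rfl⟩ := Finset.mem_image.1 hi
    have := h1 j i h
    simp only [Finset.mem_Icc]
    omega
  have hs : (Finset.Icc 1 (2*n+1) \ T.image Prod.snd).card = 1 := by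
    rw [Finset.card_sdiff_of_subset hsub, hi, Nat.card_Icc]
    omega
  obtain ⟨e, he⟩ := Finset.card_eq_one.1 hs
  have key : ∀ i, ((1 ≤ i ∧ i ≤ 2*n+1) ∧ ∀ j, (j, i) ∉ T) ↔ i = e := by
    intro i
    simpa using Finset.ext_iff.1 he i
  obtain ⟨⟨he1, he2⟩, he3⟩ := (key e).2 rfl
  refine ⟨e, ?_, he2, fun i hi hi' => ?_⟩
  · by_contra hlt
    obtain ⟨j, hj⟩ := h3 e he1 (by omega)
    exact he3 j hj
  · rw [← key i]
    simp [hi, hi']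

theorem flippedPts_subset (n : ℕ) (D : Finset (ℕ × ℕ)) : flippedPts n D ⊆ foldConf n D := by
  rintro ⟨j, i⟩ h
  rw [mem_flippedPts] at h
  exact mem_foldConf.2 ⟨h.1, Or.inr h.2⟩

/-- In a symmetric configuration, opposite rows have opposite columns. -/
theorem add_eq_of_mem_SDCF {n : ℕ} {D : Finset (ℕ × ℕ)} (hD : D ∈ SDCF (2*n+1)) {i j k : ℕ}
    (hj : (j, i) ∈ D) (hk : (k, 4*n+3 - i) ∈ D) : j + k = 2*n+2 := by
  obtain ⟨h1, h2, -, -, h5⟩ := mem_SDCF_iff.1 hD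
  have a := h1 _ _ hj
  have b := h1 _ _ hk
  have := h2 _ _ _ (h5 _ _ hj) hk
  omega

theorem mem_iff_of_mem_SDCF {n : ℕ} {D : Finset (ℕ × ℕ)} (hD : D ∈ SDCF (2*n+1)) {j i : ℕ}
    (hj1 : 1 ≤ j) (hj : j ≤ n) (hi1 : 1 ≤ i) (hi : i ≤ 4*n+2) :
    (j, i) ∈ D ↔ ((j, i) ∈ foldConf n D ∧ (j, i) ∉ flippedPts n D) ∨
      (j, 4*n+3 - i) ∈ flippedPts n D := by
  simp only [mem_foldConf, mem_flippedPts]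
  have e : 4*n+3 - (4*n+3 - i) = i := by omega
  have : (j, i) ∈ D → (j, 4*n+3 - i) ∉ D := fun h h' => by
    have := add_eq_of_mem_SDCF hD h h'
    omega
  rw [e]
  grind

theorem foldConf_mem_TnoF {n : ℕ} {D : Finset (ℕ × ℕ)} (hD : D ∈ SDCF (2*n+1)) :
    foldConf n D ∈ TnoF n := by
  obtain ⟨h1, h2, h3, h4, h5⟩ := mem_SDCF_iff.1 hD
  rw [mem_TnoF_iff]
  refine ⟨?_, ?_, ?_, ?_⟩
  · intro j i h
    obtain ⟨hb, h | h⟩ := mem_foldConf.1 h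
    · have := h1 _ _ h
      omega
    · have := h1 _ _ h
      omega
  · intro i j k hj hk
    obtain ⟨hb, hj⟩ := mem_foldConf.1 hj
    obtain ⟨hb', hk⟩ := mem_foldConf.1 hk
    rcases hj with hj | hj <;> rcases hk with hk | hk
    · exact h2 _ _ _ hj hk
    · have := add_eq_of_mem_SDCF hD hj hk
      omega
    · have := add_eq_of_mem_SDCF hD hk hj
      omega
    · exact h2 _ _ _ hj hk
  · intro i hi hi'
    obtain ⟨j, hj⟩ := h3 i hi (by omega)
    have := h1 _ _ hj
    exact ⟨j, mem_foldConf.2 ⟨by omega, Or.inl hj⟩⟩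
  · intro j hj
    rw [← h4 j (by simp only [Finset.mem_Icc] at hj ⊢; omega)]
    rw [Finset.mem_Icc] at hj
    symm
    apply card_col_eq (n := n) (flippedPts_subset n D)
    · intro j i h
      exact (mem_foldConf.1 h).1.2.2.1
    · intro j i h
      exact (mem_foldConf.1 h).1.2.2.2
    · intro i
      constructor
      · intro h
        have := h1 _ _ h
        exact ⟨by omega, (mem_iff_of_mem_SDCF hD (by omega) (by omega) (by omega) (by omega)).1 h⟩
      · rintro ⟨hi, h⟩
        refine (mem_iff_of_mem_SDCF hD (by omega) (by omega) ?_ hi).2 h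
        simp only [mem_foldConf, mem_flippedPts] at h
        omega

theorem flippedPts_mem_powerset {n : ℕ} {D : Finset (ℕ × ℕ)} (hD : D ∈ SDCF (2*n+1)) :
    flippedPts n D ∈ ((foldConf n D).filter (fun p => 2*n+2 ≤ p.2 + p.1)).powerset := by
  rw [Finset.mem_powerset]
  rintro ⟨j, i⟩ h
  refine Finset.mem_filter.2 ⟨flippedPts_subset n D h, ?_⟩
  rw [mem_flippedPts] at h
  have := (mem_SDCF_iff.1 hD).1 _ _ h.2
  dsimp only
  omega

theorem unfoldConf_mem_SDCF {n : ℕ} {T S : Finset (ℕ × ℕ)} (hT : T ∈ TnoF n)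
    (hS : S ⊆ T.filter (fun p => 2*n+2 ≤ p.2 + p.1)) : unfoldConf n T S ∈ SDCF (2*n+1) := by
  obtain ⟨e, he1, he2, he⟩ := exists_unique_empty_row hT
  obtain ⟨h1, h2, h3, h4⟩ := mem_TnoF_iff.1 hT
  have hS' : ∀ j i, (j, i) ∈ S → (j, i) ∈ T ∧ 2*n+2 ≤ i + j := fun j i h =>
    Finset.mem_filter.1 (hS h)
  have hsym : ∀ j i, (j, i) ∈ unfoldConf n T S →
      (2*n+2 - j, 4*n+3 - i) ∈ unfoldConf n T S := by
    intro j i h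
    rw [mem_unfoldConf] at h ⊢
    have e1 : 4*n+3 - (4*n+3 - i) = i := by omega
    have e2 : 2*n+2 - (2*n+2 - j) = j := by omega
    rw [e1, e2]
    grind
  have hmid : ∀ i, (n+1, i) ∈ unfoldConf n T S ↔ i = e ∨ i = 4*n+3 - e := by
    intro i
    rw [mem_unfoldConf]
    constructor
    · rintro ⟨hb, ⟨hlt, -⟩ | ⟨-, hi⟩ | ⟨hgt, -⟩⟩
      · omega
      · by_cases hi' : i ≤ 2*n+1
        · exact Or.inl ((he i hb.2.2.1 hi').1 fun k => (hi k).1)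
        · have := (he (4*n+3 - i) (by omega) (by omega)).1 fun k => (hi k).2
          omega
      · omega
    · have hee := (he e (by omega) he2).2 rfl
      have hout : ∀ k, (k, 4*n+3 - e) ∉ T := fun k hk => by
        have := h1 _ _ hk
        omega
      have e1 : 4*n+3 - (4*n+3 - e) = e := by omega
      rintro (rfl | rfl)
      · exact ⟨by omega, Or.inr (Or.inl ⟨rfl, fun k => ⟨hee k, hout k⟩⟩)⟩
      · exact ⟨by omega, Or.inr (Or.inl ⟨rfl, fun k => ⟨hout k, by rw [e1]; exact hee k⟩⟩)⟩
  rw [mem_SDCF_iff]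
  have hcol : ∀ j, 1 ≤ j → j ≤ n → ((unfoldConf n T S).filter (fun p => p.1 = j)).card = 2 := by
    intro j hj hj'
    rw [← h4 j (Finset.mem_Icc.2 ⟨hj, hj'⟩)]
    apply card_col_eq (n := n) (fun p hp => (Finset.mem_filter.1 (hS hp)).1)
    · intro j i h
      exact (h1 j i h).2.2.1
    · intro j i h
      exact (h1 j i h).2.2.2.1
    · intro i
      rw [mem_unfoldConf]
      grind
  refine ⟨?_, ?_, ?_, ?_, hsym⟩
  · intro j i h
    by_cases hj : j = n+1
    · subst hj
      rw [hmid] at h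
      omega
    · rw [mem_unfoldConf] at h
      grind
  · intro i j k hj hk
    rw [mem_unfoldConf] at hj hk
    have hST : ∀ a b, (a, b) ∈ S → (a, b) ∈ T := fun a b h => (hS' a b h).1
    have hu := h2 i
    have hu' := h2 (4*n+3 - i)
    have hx : ∀ a b, (a, i) ∈ T → (b, 4*n+3 - i) ∈ T → False := fun a b ha hb => by
      have := h1 _ _ ha
      have := h1 _ _ hb
      omega
    have hc : ∀ a, (a, i) ∈ T ∨ (a, 4*n+3 - i) ∈ T → ¬ ∀ k, (k, i) ∉ T ∧ (k, 4*n+3 - i) ∉ T :=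
      fun a ha h => ha.elim (h a).1 (h a).2
    clear hT hS he h1 h2 h3 h4 hS' hsym hmid hcol he1 he2
    rcases hj with ⟨hjb, ⟨hj0, ⟨hj, hj'⟩ | hj⟩ | ⟨hj0, hj⟩ | ⟨hj0, ⟨hj, hj'⟩ | hj⟩⟩ <;>
    rcases hk with ⟨hkb, ⟨hk0, ⟨hk, hk'⟩ | hk⟩ | ⟨hk0, hk⟩ | ⟨hk0, ⟨hk, hk'⟩ | hk⟩⟩
    all_goals first
      | omega
      | exact absurd hk (hc _ (by
          first
          | exact Or.inl hj
          | exact Or.inr hj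
          | exact Or.inl (hST _ _ hj)
          | exact Or.inr (hST _ _ hj)))
      | exact absurd hj (hc _ (by
          first
          | exact Or.inl hk
          | exact Or.inr hk
          | exact Or.inl (hST _ _ hk)
          | exact Or.inr (hST _ _ hk)))
      | grind
  · have hlow : ∀ i, 1 ≤ i → i ≤ 2*n+1 → ∃ j, (j, i) ∈ unfoldConf n T S := by
      intro i hi hi'
      by_cases hie : i = e
      · exact ⟨n+1, (hmid i).2 (Or.inl hie)⟩
      · obtain ⟨j, hj⟩ : ∃ j, (j, i) ∈ T := by
          by_contra! hno
          exact hie ((he i hi hi').1 hno)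
        have hb := h1 _ _ hj
        by_cases hs : (j, i) ∈ S
        · refine ⟨2*n+2 - j, mem_unfoldConf.2 ⟨by omega, Or.inr (Or.inr ⟨by omega, Or.inr ?_⟩)⟩⟩
          rwa [show 2*n+2 - (2*n+2 - j) = j by omega]
        · exact ⟨j, mem_unfoldConf.2 ⟨by omega, Or.inl ⟨by omega, Or.inl ⟨hj, hs⟩⟩⟩⟩
    intro i hi hi'
    by_cases h : i ≤ 2*n+1
    · exact hlow i hi h
    · obtain ⟨j, hj⟩ := hlow (4*n+3 - i) (by omega) (by omega)
      have := hsym _ _ hj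
      rw [show 4*n+3 - (4*n+3 - i) = i by omega] at this
      exact ⟨_, this⟩
  · intro j hj
    rw [Finset.mem_Icc] at hj
    rcases lt_trichotomy j (n+1) with hlt | rfl | hgt
    · exact hcol j hj.1 (by omega)
    · have : (unfoldConf n T S).filter (fun p => p.1 = n+1) = {(n+1, e), (n+1, 4*n+3 - e)} := by
        ext ⟨a, b⟩
        simp only [Finset.mem_filter, Finset.mem_insert, Finset.mem_singleton, Prod.mk.injEq]
        constructor
        · rintro ⟨h, rfl⟩
          rw [hmid] at h
          simpa using h
        · rintro (⟨rfl, rfl⟩ | ⟨rfl, rfl⟩) <;> simp [hmid]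
      rw [this, Finset.card_pair]
      simp only [ne_eq, Prod.mk.injEq, true_and]
      omega
    · rw [← hcol (2*n+2 - j) (by omega) (by omega)]
      apply Finset.card_nbij' (fun p => (2*n+2 - p.1, 4*n+3 - p.2))
        (fun p => (2*n+2 - p.1, 4*n+3 - p.2))
      · rintro ⟨a, b⟩ h
        simp only [Finset.mem_coe, Finset.mem_filter] at h ⊢
        exact ⟨hsym _ _ h.1, by omega⟩
      · rintro ⟨a, b⟩ h
        simp only [Finset.mem_coe, Finset.mem_filter] at h ⊢
        exact ⟨hsym _ _ h.1, by omega⟩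
      · rintro ⟨a, b⟩ h
        simp only [Finset.mem_coe, Finset.mem_filter, mem_unfoldConf] at h
        simp only [Prod.mk.injEq]
        omega
      · rintro ⟨a, b⟩ h
        simp only [Finset.mem_coe, Finset.mem_filter, mem_unfoldConf] at h
        simp only [Prod.mk.injEq]
        omega

theorem unfoldConf_foldConf {n : ℕ} {D : Finset (ℕ × ℕ)} (hD : D ∈ SDCF (2*n+1)) :
    unfoldConf n (foldConf n D) (flippedPts n D) = D := by
  obtain ⟨h1, h2, h3, h4, h5⟩ := mem_SDCF_iff.1 hD
  ext ⟨j, i⟩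
  by_cases hb : 1 ≤ j ∧ j ≤ 2*n+1 ∧ 1 ≤ i ∧ i ≤ 4*n+2
  swap
  · constructor
    · intro h
      exact absurd (mem_unfoldConf.1 h).1 hb
    · intro h
      have := h1 _ _ h
      omega
  have e1 : 4*n+3 - (4*n+3 - i) = i := by omega
  have e2 : 2*n+2 - (2*n+2 - j) = j := by omega
  have hs : (j, i) ∈ D ↔ (2*n+2 - j, 4*n+3 - i) ∈ D := by
    refine ⟨h5 _ _, fun h => ?_⟩
    simpa only [e1, e2] using h5 _ _ h
  rw [mem_unfoldConf]
  rcases lt_trichotomy j (n+1) with hlt | rfl | hgt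
  · rw [mem_iff_of_mem_SDCF hD (by omega) (by omega) (by omega) (by omega)]
    constructor
    · rintro ⟨-, h | h | h⟩
      · exact h.2
      · omega
      · omega
    · exact fun h => ⟨hb, Or.inl ⟨by omega, h⟩⟩
  · have : (n+1, i) ∈ D ↔ ∀ k, (k, i) ∉ foldConf n D ∧ (k, 4*n+3 - i) ∉ foldConf n D := by
      simp only [mem_foldConf, e1]
      constructor
      · intro h k
        have h' := h5 _ _ h
        rw [show 2*n+2 - (n+1) = n+1 by omega] at h'
        have hk : (k, i) ∈ D → k = n+1 := fun hk => h2 _ _ _ hk h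
        have hk' : (k, 4*n+3 - i) ∈ D → k = n+1 := fun hk => h2 _ _ _ hk h'
        grind
      · intro h
        obtain ⟨k, hk⟩ := h3 i (by omega) (by omega)
        have hb' := h1 _ _ hk
        have hk' := h5 _ _ hk
        have ha := h k
        have hc := h (2*n+2 - k)
        rcases lt_trichotomy k (n+1) with hlt | rfl | hgt
        · by_cases hi : i ≤ 2*n+1
          · exact absurd ⟨by omega, Or.inl hk⟩ ha.1
          · exact absurd ⟨by omega, Or.inr hk⟩ ha.2
        · exact hk
        · by_cases hi : i ≤ 2*n+1
          · exact absurd ⟨by omega, Or.inr hk'⟩ hc.1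
          · exact absurd ⟨by omega, Or.inl hk'⟩ hc.2
    rw [this]
    constructor
    · rintro ⟨-, h | h | h⟩
      · omega
      · exact h.2
      · omega
    · exact fun h => ⟨hb, Or.inr (Or.inl ⟨rfl, h⟩)⟩
  · rw [hs, mem_iff_of_mem_SDCF hD (by omega) (by omega) (by omega) (by omega), e1]
    constructor
    · rintro ⟨-, h | h | h⟩
      · omega
      · omega
      · exact h.2
    · exact fun h => ⟨hb, Or.inr (Or.inr ⟨by omega, h⟩)⟩

theorem fold_unfoldConf {n : ℕ} {T S : Finset (ℕ × ℕ)} (hT : T ∈ TnoF n)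
    (hS : S ⊆ T.filter (fun p => 2*n+2 ≤ p.2 + p.1)) :
    foldConf n (unfoldConf n T S) = T ∧ flippedPts n (unfoldConf n T S) = S := by
  obtain ⟨h1, h2, h3, h4⟩ := mem_TnoF_iff.1 hT
  have hS' : ∀ j i, (j, i) ∈ S → (j, i) ∈ T ∧ 2*n+2 ≤ i + j := fun j i h =>
    Finset.mem_filter.1 (hS h)
  have hST : ∀ j i, (j, i) ∈ S → (j, i) ∈ T := fun j i h => (hS' j i h).1
  have hout : ∀ j i, i ≤ 2*n+1 → (j, 4*n+3 - i) ∉ T := fun j i hi h => by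
    have := h1 _ _ h
    omega
  have hlow : ∀ j i, 1 ≤ j ∧ j ≤ n ∧ 1 ≤ i ∧ i ≤ 4*n+2 → ((j, i) ∈ unfoldConf n T S ↔
      ((j, i) ∈ T ∧ (j, i) ∉ S) ∨ (j, 4*n+3 - i) ∈ S) := by
    intro j i hb
    rw [mem_unfoldConf]
    constructor
    · rintro ⟨-, h | h | h⟩
      · exact h.2
      · omega
      · omega
    · exact fun h => ⟨by omega, Or.inl ⟨hb.2.1, h⟩⟩
  have hflip : ∀ j i, 1 ≤ j ∧ j ≤ n ∧ 1 ≤ i ∧ i ≤ 2*n+1 →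
      ((j, 4*n+3 - i) ∈ unfoldConf n T S ↔ (j, i) ∈ S) := by
    intro j i hb
    rw [hlow j (4*n+3 - i) (by omega), show 4*n+3 - (4*n+3 - i) = i by omega]
    have := hout j i hb.2.2.2
    tauto
  have hkeep : ∀ j i, 1 ≤ j ∧ j ≤ n ∧ 1 ≤ i ∧ i ≤ 2*n+1 →
      ((j, i) ∈ unfoldConf n T S ↔ (j, i) ∈ T ∧ (j, i) ∉ S) := by
    intro j i hb
    rw [hlow j i (by omega)]
    have := hout j i hb.2.2.2
    have := hST j (4*n+3 - i)
    tauto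
  have hbox : ∀ j i, (j, i) ∈ T → 1 ≤ j ∧ j ≤ n ∧ 1 ≤ i ∧ i ≤ 2*n+1 := fun j i h => by
    have := h1 _ _ h
    omega
  constructor <;> ext ⟨j, i⟩
  · rw [mem_foldConf]
    have := hflip j i
    have := hkeep j i
    have := hbox j i
    have := hST j i
    grind only
  · rw [mem_flippedPts]
    have := hflip j i
    have := hbox j i
    have := hST j i
    grind only

/-- **Formula (6).** `|SDC_{2n+1}| = Σ_{T ∈ T_n^o} 2^{fr(T)}`. -/
theorem statement3 (n : ℕ) (hn : 1 ≤ n) :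
    (SDCF (2*n + 1)).card = ∑ T ∈ TnoF n, 2 ^ (frO n T) := by
  have h : ∑ T ∈ TnoF n, 2 ^ (frO n T) = ((TnoF n).sigma (fun T =>
      (T.filter (fun p => 2*n+2 ≤ p.2 + p.1)).powerset)).card := by
    simp only [Finset.card_sigma, Finset.card_powerset, frO]
  rw [h]
  apply Finset.card_nbij' (fun D => ⟨foldConf n D, flippedPts n D⟩)
    (fun x => unfoldConf n x.1 x.2)
  · intro D hD
    exact Finset.mem_sigma.2 ⟨foldConf_mem_TnoF hD, flippedPts_mem_powerset hD⟩
  · rintro ⟨T, S⟩ h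
    obtain ⟨hT, hS⟩ := Finset.mem_sigma.1 h
    exact unfoldConf_mem_SDCF hT (Finset.mem_powerset.1 hS)
  · intro D hD
    exact unfoldConf_foldConf hD
  · rintro ⟨T, S⟩ h
    obtain ⟨hT, hS⟩ := Finset.mem_sigma.1 h
    obtain ⟨e1, e2⟩ := fold_unfoldConf hT (Finset.mem_powerset.1 hS)
    dsimp only
    rw [e1, e2]

end SymDellac
end

section
/- For every integer n ≥ 1, the number of symmetric Dellac configurations of size 2n−1 equals P_n(1), i.e., |SDC_{2n−1}| = P_n(1). -/
open scoped Classical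

namespace SymDellac




/-- `φ_{m,k}`, the coefficient of `λ ^ k` in the generating polynomial attached to `m` column pairs. -/
def phiCoeff : ℕ → ℕ → ℚ
  | 0, k => if k = 0 then 1 else 0
  | _ + 1, 0 => 0
  | m + 1, k + 1 => ((k + 2).choose 2 : ℚ) * (phiCoeff m k - phiCoeff m (k + 1))

/-- `2 ^ (k - 1) * C(x + k - 1, k - 1)`, with value `0` at `k = 0`. -/
def newtonB : ℕ → ℕ → ℚ
  | 0, _ => 0
  | k + 1, x => 2 ^ k * ((x + k).choose k : ℚ)

theorem phiCoeff_eq_zero_of_lt {m k : ℕ} (h : m < k) : phiCoeff m k = 0 := by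
  induction m generalizing k with
  | zero => simp [phiCoeff, h.ne']
  | succ m ih =>
    obtain ⟨k, rfl⟩ : ∃ l, k = l + 1 := ⟨k - 1, by omega⟩
    simp [phiCoeff, ih (show m < k by omega), ih (show m < k + 1 by omega)]

theorem newtonB_shift_two (k x : ℕ) :
    ((x : ℚ) + 2) * (x + 1) * newtonB k (x + 2) = (x + k + 1) * (x + k) * newtonB k x := by
  cases k with
  | zero => simp [newtonB]
  | succ k =>
    have h1 := Nat.add_one_mul_choose_eq (x + k) x
    have h2 := Nat.add_one_mul_choose_eq (x + k + 1) (x + 1)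
    simp only [newtonB]
    rw [Nat.choose_symm_of_eq_add (show x + k = k + x by omega),
      Nat.choose_symm_of_eq_add (show x + 2 + k = k + (x + 1 + 1) by omega),
      show x + 2 + k = x + k + 1 + 1 by omega]
    have h1' : ((x : ℚ) + k + 1) * (x + k).choose x = (x + k + 1).choose (x + 1) * (x + 1) := by
      exact_mod_cast h1
    have h2' : ((x : ℚ) + k + 1 + 1) * (x + k + 1).choose (x + 1)
        = (x + k + 1 + 1).choose (x + 1 + 1) * (x + 1 + 1) := by exact_mod_cast h2
    push_cast
    linear_combination (-(2 : ℚ) ^ k * (x + 1)) * h2' - (2 : ℚ) ^ k * (x + k + 2) * h1'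

theorem newtonB_succ (k x : ℕ) :
    (k : ℚ) * newtonB (k + 1) x = 2 * (x + k) * newtonB k x := by
  cases k with
  | zero => simp [newtonB]
  | succ k =>
    have h1 : ((x : ℚ) + k + 1) * (x + k).choose k = (x + k + 1).choose (k + 1) * (k + 1) := by
      exact_mod_cast Nat.add_one_mul_choose_eq (x + k) k
    simp only [newtonB, ← add_assoc]
    push_cast
    linear_combination (-(2 : ℚ) ^ (k + 1)) * h1

theorem newtonB_recurrence (k x : ℕ) :
    (1 / 2 : ℚ) * ((x + 2) * (x + 1) * (newtonB (k + 1) (x + 2) - newtonB k (x + 2))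
        - x * (x - 1) * (newtonB (k + 1) x - newtonB k x)) =
      ((k + 2).choose 2 : ℚ) * (newtonB (k + 2) x - newtonB (k + 1) x)
        - ((k + 1).choose 2 : ℚ) * (newtonB (k + 1) x - newtonB k x) := by
  have h1 := newtonB_shift_two k x
  have h2 := newtonB_shift_two (k + 1) x
  have h3 := newtonB_succ k x
  have h4 := newtonB_succ (k + 1) x
  rw [Nat.cast_choose_two, Nat.cast_choose_two]
  push_cast at *
  linear_combination (1 / 2 : ℚ) * h2 - (1 / 2 : ℚ) * h1 - (1 / 2 : ℚ) * (k + 2) * h4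
    + (1 / 2 : ℚ) * (k + 1) * h3

theorem P_eval_natCast (m x : ℕ) :
    (P (m + 1)).eval (x : ℚ) =
      ∑ k ∈ Finset.range (m + 1), phiCoeff m k * (newtonB (k + 1) x - newtonB k x) := by
  induction m generalizing x with
  | zero => simp [P, phiCoeff, newtonB]
  | succ m ih =>
    have h2 := ih (x + 2)
    push_cast at h2
    have hP : (P (m + 1 + 1)).eval (x : ℚ) = (1 / 2 : ℚ) *
        ((x + 2) * (x + 1) * (P (m + 1)).eval ((x : ℚ) + 2)
          - x * (x - 1) * (P (m + 1)).eval (x : ℚ)) := by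
      simp [P, Polynomial.eval_comp]
    rw [hP, h2, ih x, Finset.mul_sum, Finset.mul_sum, ← Finset.sum_sub_distrib, Finset.mul_sum]
    have hk : ∀ k : ℕ, (1 / 2 : ℚ) * ((x + 2) * (x + 1) *
          (phiCoeff m k * (newtonB (k + 1) (x + 2) - newtonB k (x + 2)))
          - x * (x - 1) * (phiCoeff m k * (newtonB (k + 1) x - newtonB k x))) =
        phiCoeff m k * (((k + 2).choose 2 : ℚ) * (newtonB (k + 2) x - newtonB (k + 1) x))
        - phiCoeff m k * (((k + 1).choose 2 : ℚ) * (newtonB (k + 1) x - newtonB k x)) := by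
      intro k
      linear_combination phiCoeff m k * newtonB_recurrence k x
    rw [Finset.sum_congr rfl fun k _ => hk k, Finset.sum_sub_distrib]
    have hshift : ∑ k ∈ Finset.range (m + 1),
        phiCoeff m k * (((k + 1).choose 2 : ℚ) * (newtonB (k + 1) x - newtonB k x)) =
        ∑ k ∈ Finset.range (m + 1), phiCoeff m (k + 1) *
          (((k + 2).choose 2 : ℚ) * (newtonB (k + 2) x - newtonB (k + 1) x)) := by
      rw [Finset.sum_range_succ', Finset.sum_range_succ, phiCoeff_eq_zero_of_lt (Nat.lt_succ_self m)]
      simp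
    rw [hshift, ← Finset.sum_sub_distrib, Finset.sum_range_succ' _ (m + 1)]
    simp only [phiCoeff, zero_mul, add_zero]
    exact Finset.sum_congr rfl fun k _ => by ring


/-- The linear form `X_0 + ⋯ + X_{m-1}`. -/
noncomputable def linSum (m : ℕ) : MvPolynomial ℕ ℚ := ∑ j ∈ Finset.range m, MvPolynomial.X j

/-- The coefficient of `T ^ k` in `∏ i < m, (T - linSum i)`. -/
noncomputable def prodCoeff : ℕ → ℕ → MvPolynomial ℕ ℚ
  | 0, k => if k = 0 then 1 else 0
  | m + 1, 0 => -linSum m * prodCoeff m 0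
  | m + 1, k + 1 => prodCoeff m k - linSum m * prodCoeff m (k + 1)

/-- The exponent of `X_0 ^ 2 ⋯ X_{m-1} ^ 2`. -/
noncomputable def pairExp (m : ℕ) : ℕ →₀ ℕ := ∑ j ∈ Finset.range m, Finsupp.single j 2

theorem linSum_succ (m : ℕ) : linSum (m + 1) = linSum m + MvPolynomial.X m :=
  Finset.sum_range_succ _ _

theorem pairExp_succ (m : ℕ) : pairExp (m + 1) = pairExp m + Finsupp.single m 2 :=
  Finset.sum_range_succ _ _

theorem pairExp_apply (m v : ℕ) : pairExp m v = if v < m then 2 else 0 := by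
  simp [pairExp, Finsupp.finsetSum_apply, Finsupp.single_apply]

theorem linSum_mem_supported {i m : ℕ} (h : i ≤ m) :
    linSum i ∈ MvPolynomial.supported ℚ (Set.Iio m) :=
  Subalgebra.sum_mem _ fun _ hj => MvPolynomial.X_mem_supported.2
    (lt_of_lt_of_le (Finset.mem_range.1 hj) h)

theorem prodCoeff_eq_zero_of_lt {m k : ℕ} (h : m < k) : prodCoeff m k = 0 := by
  induction m generalizing k with
  | zero => simp [prodCoeff, h.ne']
  | succ m ih =>
    obtain ⟨k, rfl⟩ : ∃ l, k = l + 1 := ⟨k - 1, by omega⟩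
    simp [prodCoeff, ih (show m < k by omega), ih (show m < k + 1 by omega)]

theorem prodCoeff_mem_supported {i m : ℕ} (h : i ≤ m + 1) (k : ℕ) :
    prodCoeff i k ∈ MvPolynomial.supported ℚ (Set.Iio m) := by
  induction i generalizing k with
  | zero =>
    unfold prodCoeff
    split_ifs
    exacts [Subalgebra.one_mem _, Subalgebra.zero_mem _]
  | succ i ih =>
    have hS := linSum_mem_supported (show i ≤ m by omega)
    have ih' := ih (by omega)
    cases k with
    | zero => exact Subalgebra.mul_mem _ (Subalgebra.neg_mem _ hS) (ih' 0)
    | succ k => exact Subalgebra.sub_mem _ (ih' k) (Subalgebra.mul_mem _ hS (ih' (k + 1)))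

theorem prod_sub_linSum (m : ℕ) (T : MvPolynomial ℕ ℚ) :
    ∏ i ∈ Finset.range m, (T - linSum i) = ∑ k ∈ Finset.range (m + 1), prodCoeff m k * T ^ k := by
  induction m with
  | zero => simp [prodCoeff]
  | succ m ih =>
    rw [Finset.prod_range_succ, ih, mul_sub, Finset.sum_mul, Finset.sum_range_succ' _ (m + 1)]
    have h : (∑ k ∈ Finset.range (m + 1), prodCoeff m k * T ^ k) * linSum m =
        ∑ k ∈ Finset.range (m + 1), linSum m * prodCoeff m (k + 1) * T ^ (k + 1)
          + linSum m * prodCoeff m 0 := by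
      rw [Finset.sum_range_succ', Finset.sum_range_succ,
        prodCoeff_eq_zero_of_lt (Nat.lt_succ_self m), add_mul, Finset.sum_mul]
      simp only [mul_zero, zero_mul, add_zero, pow_zero, mul_one]
      rw [mul_comm (prodCoeff m 0)]
      exact congrArg₂ _ (Finset.sum_congr rfl fun k _ => by ring) rfl
    rw [h, ← sub_sub, ← Finset.sum_sub_distrib]
    simp only [prodCoeff, pow_zero, mul_one, neg_mul, ← sub_eq_add_neg]
    exact congrArg₂ _ (Finset.sum_congr rfl fun k _ => by ring) rfl

theorem coeff_eq_zero_of_mem_supported {m : ℕ} {Q : MvPolynomial ℕ ℚ}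
    (hQ : Q ∈ MvPolynomial.supported ℚ (Set.Iio m)) {e : ℕ →₀ ℕ} (he : e m ≠ 0) :
    Q.coeff e = 0 := by
  by_contra h
  have hm : m ∈ Q.vars := (MvPolynomial.mem_vars_iff_mem_support m).2
    ⟨e, MvPolynomial.mem_support_iff.2 h, Finsupp.mem_support_iff.2 he⟩
  exact lt_irrefl m (MvPolynomial.mem_supported.1 hQ hm)

theorem coeff_mul_add_X_pow {m : ℕ} {A B : MvPolynomial ℕ ℚ}
    (hA : A ∈ MvPolynomial.supported ℚ (Set.Iio m))
    (hB : B ∈ MvPolynomial.supported ℚ (Set.Iio m)) {d : ℕ →₀ ℕ} (hd : d m = 0) (a p : ℕ) :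
    (A * (B + MvPolynomial.X m) ^ p).coeff (d + Finsupp.single m a) =
      p.choose a * (A * B ^ (p - a)).coeff d := by
  have hterm : ∀ i, (A * (MvPolynomial.X m ^ i * B ^ (p - i) * (p.choose i : MvPolynomial ℕ ℚ))).coeff
      (d + Finsupp.single m a) =
      if i = a then (p.choose a : ℚ) * (A * B ^ (p - a)).coeff d else 0 := by
    intro i
    have hQ : A * B ^ (p - i) ∈ MvPolynomial.supported ℚ (Set.Iio m) :=
      Subalgebra.mul_mem _ hA (Subalgebra.pow_mem _ hB _)
    have hrw : A * (MvPolynomial.X m ^ i * B ^ (p - i) * (p.choose i : MvPolynomial ℕ ℚ)) =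
        A * B ^ (p - i) * MvPolynomial.monomial (Finsupp.single m i) (p.choose i : ℚ) := by
      rw [← mul_one (p.choose i : ℚ), ← MvPolynomial.C_mul_monomial, ← MvPolynomial.X_pow_eq_monomial,
        map_natCast]
      ring
    rw [hrw, MvPolynomial.coeff_mul_monomial']
    split_ifs with h1 h2 h2
    · subst h2
      rw [add_tsub_cancel_right, mul_comm]
    · rw [coeff_eq_zero_of_mem_supported hQ, zero_mul]
      have := h1 m
      simp only [Finsupp.add_apply, hd, Finsupp.single_eq_same, Finsupp.tsub_apply] at this ⊢
      omega
    · subst h2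
      exact absurd (self_le_add_left _ _) h1
    · rfl
  rw [add_comm B, add_pow, Finset.mul_sum, MvPolynomial.coeff_sum,
    Finset.sum_congr rfl fun i _ => hterm i, Finset.sum_ite_eq']
  split_ifs with h
  · rfl
  · rw [Nat.choose_eq_zero_of_lt (by simpa using h)]
    simp

theorem prod_linSum_mem_supported (m : ℕ) :
    ∏ i ∈ Finset.range m, linSum (i + 1) ∈ MvPolynomial.supported ℚ (Set.Iio m) :=
  Subalgebra.prod_mem _ fun _ hi => linSum_mem_supported (Finset.mem_range.1 hi)

theorem coeff_prod_mul_prodCoeff_succ {m : ℕ}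
    (ih : ∀ k, ((∏ i ∈ Finset.range m, linSum (i + 1)) * prodCoeff m k * linSum m ^ k).coeff
      (pairExp m) = phiCoeff m k) (k : ℕ) :
    ((∏ i ∈ Finset.range m, linSum (i + 1)) * prodCoeff (m + 1) (k + 1) * linSum m ^ k).coeff
      (pairExp m) = phiCoeff m k - phiCoeff m (k + 1) := by
  rw [← ih, ← ih, ← MvPolynomial.coeff_sub, prodCoeff]
  congr 1
  ring

theorem coeff_pairExp (m k : ℕ) :
    ((∏ i ∈ Finset.range m, linSum (i + 1)) * prodCoeff m k * linSum m ^ k).coeff (pairExp m) =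
      phiCoeff m k := by
  induction m generalizing k with
  | zero => cases k <;> simp [prodCoeff, phiCoeff, pairExp]
  | succ m ih =>
    have hrw : (∏ i ∈ Finset.range (m + 1), linSum (i + 1)) * prodCoeff (m + 1) k
          * linSum (m + 1) ^ k =
        (∏ i ∈ Finset.range m, linSum (i + 1)) * prodCoeff (m + 1) k
          * (linSum m + MvPolynomial.X m) ^ (k + 1) := by
      rw [Finset.prod_range_succ, linSum_succ]
      ring
    rw [hrw, pairExp_succ, coeff_mul_add_X_pow (Subalgebra.mul_mem _ (prod_linSum_mem_supported m)
      (prodCoeff_mem_supported le_rfl k)) (linSum_mem_supported le_rfl) (by simp [pairExp_apply])]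
    cases k with
    | zero => simp [phiCoeff]
    | succ k =>
      rw [show k + 1 + 1 - 2 = k by omega, coeff_prod_mul_prodCoeff_succ ih]
      rfl

theorem coeff_pairExp_add_single (m : ℕ) :
    ((∏ i ∈ Finset.range m, linSum (i + 1)) *
        ∏ i ∈ Finset.range (m + 1), (2 * linSum m + MvPolynomial.X m - linSum i)).coeff
      (pairExp m + Finsupp.single m 1) = (P (m + 1)).eval 1 := by
  have hterm : ∀ k, ((∏ i ∈ Finset.range m, linSum (i + 1)) *
      (prodCoeff (m + 1) (k + 1) * (2 * linSum m + MvPolynomial.X m) ^ (k + 1))).coeff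
        (pairExp m + Finsupp.single m 1) =
      newtonB (k + 1) 1 * phiCoeff m k - newtonB (k + 1) 1 * phiCoeff m (k + 1) := by
    intro k
    have hS := linSum_mem_supported (le_refl m)
    have h2 : (2 : MvPolynomial ℕ ℚ) * linSum m ∈ MvPolynomial.supported ℚ (Set.Iio m) := by
      rw [two_mul]
      exact Subalgebra.add_mem _ hS hS
    rw [← mul_assoc, coeff_mul_add_X_pow (Subalgebra.mul_mem _ (prod_linSum_mem_supported m)
      (prodCoeff_mem_supported le_rfl (k + 1))) h2 (by simp [pairExp_apply]), Nat.add_sub_cancel,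
      mul_pow, ← mul_sub, ← coeff_prod_mul_prodCoeff_succ (coeff_pairExp m)]
    have hC : (2 : MvPolynomial ℕ ℚ) ^ k = MvPolynomial.C (2 ^ k) := by
      rw [map_pow, map_ofNat]
    rw [mul_left_comm, hC, MvPolynomial.coeff_C_mul, newtonB, Nat.add_comm 1 k, Nat.choose_one_right,
      Nat.choose_succ_self_right]
    ring
  have h0 : ((∏ i ∈ Finset.range m, linSum (i + 1)) *
      (prodCoeff (m + 1) 0 * (2 * linSum m + MvPolynomial.X m) ^ 0)).coeff
        (pairExp m + Finsupp.single m 1) = 0 := by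
    rw [pow_zero, mul_one]
    refine coeff_eq_zero_of_mem_supported (m := m) (Subalgebra.mul_mem _
      (prod_linSum_mem_supported m) (prodCoeff_mem_supported le_rfl 0)) ?_
    simp [pairExp_apply]
  have hP := P_eval_natCast m 1
  rw [Nat.cast_one] at hP
  rw [hP, prod_sub_linSum, Finset.mul_sum, MvPolynomial.coeff_sum, Finset.sum_range_succ', h0,
    Finset.sum_congr rfl fun k _ => hterm k, Finset.sum_sub_distrib]
  have hshift : ∑ k ∈ Finset.range (m + 1), newtonB (k + 1) 1 * phiCoeff m (k + 1) =
      ∑ k ∈ Finset.range (m + 1), newtonB k 1 * phiCoeff m k := by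
    rw [Finset.sum_range_succ, Finset.sum_range_succ', phiCoeff_eq_zero_of_lt (Nat.lt_succ_self m)]
    simp [newtonB]
  rw [hshift, ← Finset.sum_sub_distrib, add_zero]
  exact Finset.sum_congr rfl fun k _ => by ring

/-- The column pair `{j, 2m - j}` containing column `j`, represented by its smaller element. -/
def foldCol (m j : ℕ) : ℕ := min j (2 * m - j)

/-- The lower halves of symmetric Dellac configurations of size `2m + 1`, encoded by the (zero-based)
column of each of the first `2m + 1` rows. -/
noncomputable def halfConfigs (m : ℕ) : Finset (Fin (2 * m + 1) → ℕ) :=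
  (Fintype.piFinset fun k : Fin (2 * m + 1) => Finset.range (k + 1)).filter fun c =>
    ∑ k, Finsupp.single (foldCol m (c k)) 1 = pairExp m + Finsupp.single m 1

/-- The symmetric set of points whose first `N` rows are given by `c`. -/
def symPoints (N : ℕ) (c : Fin N → ℕ) : Finset (ℕ × ℕ) :=
  Finset.univ.image (fun k : Fin N => (c k + 1, (k : ℕ) + 1)) ∪
    Finset.univ.image (fun k : Fin N => (N - c k, 2 * N - k))

theorem sum_X_foldCol_of_le {m k : ℕ} (h : k ≤ m) :
    ∑ j ∈ Finset.range k, (MvPolynomial.X (foldCol m j) : MvPolynomial ℕ ℚ) = linSum k := by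
  refine Finset.sum_congr rfl fun j hj => ?_
  rw [Finset.mem_range] at hj
  rw [foldCol, min_eq_left (by omega)]

theorem sum_X_foldCol (m i : ℕ) (h : i ≤ m) :
    ∑ j ∈ Finset.range (2 * m + 1 - i), (MvPolynomial.X (foldCol m j) : MvPolynomial ℕ ℚ) =
      2 * linSum m + MvPolynomial.X m - linSum i := by
  induction i with
  | zero =>
    rw [Nat.sub_zero, show 2 * m + 1 = (m + 1) + m by omega, Finset.sum_range_add,
      Finset.sum_range_succ, sum_X_foldCol_of_le le_rfl, ← Finset.sum_range_reflect]
    have : ∑ j ∈ Finset.range m,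
        (MvPolynomial.X (foldCol m (m + 1 + (m - 1 - j))) : MvPolynomial ℕ ℚ) = linSum m := by
      refine Finset.sum_congr rfl fun j hj => ?_
      rw [Finset.mem_range] at hj
      congr 1
      simp only [foldCol]
      omega
    rw [this, show foldCol m m = m by simp only [foldCol]; omega]
    simp only [linSum, Finset.range_zero, Finset.sum_empty]
    ring
  | succ i ih =>
    have ih' := ih (by omega)
    rw [show 2 * m + 1 - i = (2 * m + 1 - (i + 1)) + 1 by omega, Finset.sum_range_succ,
      show foldCol m (2 * m + 1 - (i + 1)) = i by simp only [foldCol]; omega] at ih'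
    rw [linSum_succ, ← sub_sub, ← ih', add_sub_cancel_right]

theorem card_halfConfigs (m : ℕ) : ((halfConfigs m).card : ℚ) = (P (m + 1)).eval 1 := by
  have hprod : ∏ k : Fin (2 * m + 1), ∑ j ∈ Finset.range ((k : ℕ) + 1),
      (MvPolynomial.X (foldCol m j) : MvPolynomial ℕ ℚ) =
      (∏ i ∈ Finset.range m, linSum (i + 1)) *
        ∏ i ∈ Finset.range (m + 1), (2 * linSum m + MvPolynomial.X m - linSum i) := by
    rw [Fin.prod_univ_eq_prod_range (fun k => ∑ j ∈ Finset.range (k + 1),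
      (MvPolynomial.X (foldCol m j) : MvPolynomial ℕ ℚ)), show 2 * m + 1 = m + (m + 1) by omega,
      Finset.prod_range_add]
    congr 1
    · exact Finset.prod_congr rfl fun k hk => sum_X_foldCol_of_le (Finset.mem_range.1 hk)
    · rw [← Finset.prod_range_reflect]
      refine Finset.prod_congr rfl fun k hk => ?_
      rw [Finset.mem_range] at hk
      rw [← sum_X_foldCol m k (by omega)]
      congr 2
      omega
  have hX : ∀ c : Fin (2 * m + 1) → ℕ,
      ∏ k, (MvPolynomial.X (foldCol m (c k)) : MvPolynomial ℕ ℚ) =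
        MvPolynomial.monomial (∑ k, Finsupp.single (foldCol m (c k)) 1) 1 := by
    intro c
    rw [MvPolynomial.monomial_sum_one]
    rfl
  rw [← coeff_pairExp_add_single, ← hprod, Finset.prod_univ_sum, MvPolynomial.coeff_sum]
  simp only [hX, MvPolynomial.coeff_monomial]
  rw [Finset.sum_boole, halfConfigs]

theorem mem_symPoints {N : ℕ} {c : Fin N → ℕ} {p : ℕ × ℕ} :
    p ∈ symPoints N c ↔ (∃ k : Fin N, (c k + 1, (k : ℕ) + 1) = p) ∨
      ∃ k : Fin N, (N - c k, 2 * N - (k : ℕ)) = p := by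
  simp [symPoints]

theorem card_filter_symPoints {N : ℕ} (c : Fin N → ℕ) (q : ℕ × ℕ → Prop)
    [DecidablePred q] :
    ((symPoints N c).filter q).card =
      (Finset.univ.filter fun k : Fin N => q (c k + 1, (k : ℕ) + 1)).card +
        (Finset.univ.filter fun k : Fin N => q (N - c k, 2 * N - (k : ℕ))).card := by
  rw [symPoints, Finset.filter_union, Finset.card_union_of_disjoint, Finset.filter_image,
    Finset.filter_image, Finset.card_image_of_injective, Finset.card_image_of_injective]
  · intro k l h
    have := congrArg Prod.snd h
    simp only at this
    omega
  · intro k l h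
    have := congrArg Prod.snd h
    simp only at this
    omega
  · refine Finset.disjoint_filter_filter (Finset.disjoint_left.2 ?_)
    simp only [Finset.mem_image, Finset.mem_univ, true_and]
    rintro p ⟨k, rfl⟩ ⟨l, hl⟩
    have := congrArg Prod.snd hl
    simp only at this
    omega

theorem card_filter_row_symPoints {N : ℕ} (c : Fin N → ℕ) {i : ℕ} (hi : i ∈ Finset.Icc 1 (2 * N)) :
    ((symPoints N c).filter fun p => p.2 = i).card = 1 := by
  rw [Finset.mem_Icc] at hi
  rw [card_filter_symPoints]
  by_cases h : i ≤ N
  · have h1 : (Finset.univ.filter fun k : Fin N => (k : ℕ) + 1 = i) = {⟨i - 1, by omega⟩} := by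
      ext k
      simp only [Finset.mem_filter, Finset.mem_univ, true_and, Finset.mem_singleton, Fin.ext_iff]
      omega
    have h2 : (Finset.univ.filter fun k : Fin N => 2 * N - (k : ℕ) = i) = ∅ := by
      ext k
      simp only [Finset.mem_filter, Finset.mem_univ, true_and, Finset.notMem_empty, iff_false]
      omega
    simp only [h1, h2, Finset.card_singleton, Finset.card_empty]
  · have h1 : (Finset.univ.filter fun k : Fin N => (k : ℕ) + 1 = i) = ∅ := by
      ext k
      simp only [Finset.mem_filter, Finset.mem_univ, true_and, Finset.notMem_empty, iff_false]
      omega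
    have h2 : (Finset.univ.filter fun k : Fin N => 2 * N - (k : ℕ) = i) =
        {⟨2 * N - i, by omega⟩} := by
      ext k
      simp only [Finset.mem_filter, Finset.mem_univ, true_and, Finset.mem_singleton, Fin.ext_iff]
      omega
    simp only [h1, h2, Finset.card_singleton, Finset.card_empty]

theorem sum_single_foldCol_eq_iff {m : ℕ} {c : Fin (2 * m + 1) → ℕ} (hc : ∀ k, c k ≤ k) :
    (∑ k, Finsupp.single (foldCol m (c k)) 1 = pairExp m + Finsupp.single m 1) ↔
      ∀ j ∈ Finset.Icc 1 (2 * m + 1),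
        ((symPoints (2 * m + 1) c).filter fun p => p.1 = j).card = 2 := by
  have hsum : ∀ v, (∑ k, Finsupp.single (foldCol m (c k)) 1 : ℕ →₀ ℕ) v =
      (Finset.univ.filter fun k => foldCol m (c k) = v).card := by
    intro v
    simp [Finsupp.finsetSum_apply, Finsupp.single_apply]
  have hexp : ∀ v, (pairExp m + Finsupp.single m 1 : ℕ →₀ ℕ) v =
      if v < m then 2 else if v = m then 1 else 0 := by
    intro v
    rw [Finsupp.add_apply, pairExp_apply, Finsupp.single_apply]
    split_ifs <;> omega
  have hcol : ∀ v, v ≠ m → v ≤ 2 * m →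
      ((symPoints (2 * m + 1) c).filter fun p => p.1 = v + 1).card =
        (Finset.univ.filter fun k => foldCol m (c k) = foldCol m v).card := by
    intro v hv hv'
    rw [card_filter_symPoints, ← Finset.card_union_of_disjoint, ← Finset.filter_or]
    · congr 1
      ext k
      have := hc k
      rw [Finset.mem_filter, Finset.mem_filter]
      simp only [Finset.mem_univ, true_and, foldCol]
      omega
    · rw [Finset.disjoint_filter]
      intro k _ h1 h2
      have := hc k
      dsimp only at h1 h2
      omega
  have hmid : ((symPoints (2 * m + 1) c).filter fun p => p.1 = m + 1).card =
      2 * (Finset.univ.filter fun k => foldCol m (c k) = m).card := by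
    rw [card_filter_symPoints, two_mul (Finset.card _)]
    congr 2
    all_goals
      ext k
      have := hc k
      rw [Finset.mem_filter, Finset.mem_filter]
      simp only [Finset.mem_univ, true_and, foldCol]
      omega
  rw [DFunLike.ext_iff]
  simp only [hsum, hexp]
  constructor
  · intro h j hj
    rw [Finset.mem_Icc] at hj
    obtain ⟨v, rfl⟩ : ∃ v, j = v + 1 := ⟨j - 1, by omega⟩
    by_cases hv : v = m
    · subst hv
      rw [hmid, h]
      simp
    · rw [hcol v hv (by omega), h, if_pos]
      simp only [foldCol]
      omega
  · intro h v
    split_ifs with h1 h2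
    · have hf : foldCol m v = v := by
        simp only [foldCol]
        omega
      have := hcol v h1.ne (by omega)
      rw [hf] at this
      rw [← this, h _ (Finset.mem_Icc.2 ⟨by omega, by omega⟩)]
    · subst h2
      have := h (v + 1) (Finset.mem_Icc.2 ⟨by omega, by omega⟩)
      omega
    · rw [Finset.card_eq_zero, Finset.filter_eq_empty_iff]
      intro k _
      simp only [foldCol]
      omega

theorem le_of_mem_halfConfigs {m : ℕ} {c : Fin (2 * m + 1) → ℕ} (hc : c ∈ halfConfigs m)
    (k : Fin (2 * m + 1)) : c k ≤ k := by
  have := Fintype.mem_piFinset.1 (Finset.mem_filter.1 hc).1 k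
  rw [Finset.mem_range] at this
  omega

theorem symPoints_mem_SDCF {m : ℕ} {c : Fin (2 * m + 1) → ℕ} (hc : c ∈ halfConfigs m) :
    symPoints (2 * m + 1) c ∈ SDCF (2 * m + 1) := by
  have hle := le_of_mem_halfConfigs hc
  have hpt : ∀ p ∈ symPoints (2 * m + 1) c, 1 ≤ p.1 ∧ p.1 ≤ 2 * m + 1 ∧ 1 ≤ p.2 ∧
      p.2 ≤ 2 * (2 * m + 1) ∧ p.1 ≤ p.2 ∧ p.2 ≤ 2 * m + 1 + p.1 := by
    intro p hp
    obtain ⟨k, rfl⟩ | ⟨k, rfl⟩ := mem_symPoints.1 hp <;>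
    · have := hle k
      dsimp only
      omega
  refine Finset.mem_filter.2 ⟨Finset.mem_powerset.2 fun p hp => ?_, ⟨hpt, fun i hi =>
    card_filter_row_symPoints c hi, (sum_single_foldCol_eq_iff hle).1 (Finset.mem_filter.1 hc).2⟩,
    fun p hp => ?_⟩
  · obtain ⟨h1, h2, h3, h4, -⟩ := hpt p hp
    exact Finset.mem_product.2 ⟨Finset.mem_Icc.2 ⟨h1, h2⟩, Finset.mem_Icc.2 ⟨h3, h4⟩⟩
  · rw [mem_symPoints] at hp ⊢
    obtain ⟨k, rfl⟩ | ⟨k, rfl⟩ := hp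
    · right
      refine ⟨k, Prod.ext ?_ ?_⟩ <;> dsimp only <;> omega
    · left
      have := hle k
      refine ⟨k, Prod.ext ?_ ?_⟩ <;> dsimp only <;> omega

theorem symPoints_injective (N : ℕ) : Function.Injective (symPoints N) := by
  intro c c' h
  funext k
  have hk : (c k + 1, (k : ℕ) + 1) ∈ symPoints N c := mem_symPoints.2 (Or.inl ⟨k, rfl⟩)
  rw [h, mem_symPoints] at hk
  obtain ⟨l, hl⟩ | ⟨l, hl⟩ := hk <;> rw [Prod.mk.injEq] at hl
  · obtain rfl : l = k := Fin.ext (by omega)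
    omega
  · omega

theorem exists_symPoints_eq {m : ℕ} {D : Finset (ℕ × ℕ)} (hD : D ∈ SDCF (2 * m + 1)) :
    ∃ c ∈ halfConfigs m, symPoints (2 * m + 1) c = D := by
  obtain ⟨-, ⟨hpt, hrow, hcol⟩, hsymm⟩ := Finset.mem_filter.1 hD
  have hex : ∀ k : Fin (2 * m + 1), ∃ j, (j + 1, (k : ℕ) + 1) ∈ D := by
    intro k
    obtain ⟨p, hp⟩ := Finset.card_eq_one.1 (hrow (k + 1) (Finset.mem_Icc.2 ⟨by omega, by omega⟩))
    have hpD := Finset.mem_filter.1 (hp ▸ Finset.mem_singleton_self p)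
    have := hpt p hpD.1
    refine ⟨p.1 - 1, ?_⟩
    rw [← hpD.2, show p.1 - 1 + 1 = p.1 by omega]
    exact hpD.1
  choose c hc using hex
  have hle : ∀ k, c k ≤ k := fun k => by
    have := hpt _ (hc k)
    dsimp only at this
    omega
  have hlow : ∀ p ∈ D, p.2 ≤ 2 * m + 1 → ∃ k : Fin (2 * m + 1), (c k + 1, (k : ℕ) + 1) = p := by
    intro p hp hp2
    have hb := hpt p hp
    refine ⟨⟨p.2 - 1, by omega⟩, ?_⟩
    refine Finset.card_le_one.1 (hrow p.2 (Finset.mem_Icc.2 ⟨by omega, by omega⟩)).le _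
      (Finset.mem_filter.2 ⟨hc _, ?_⟩) p (Finset.mem_filter.2 ⟨hp, rfl⟩)
    dsimp only
    omega
  have heq : symPoints (2 * m + 1) c = D := by
    ext p
    rw [mem_symPoints]
    constructor
    · rintro (⟨k, rfl⟩ | ⟨k, rfl⟩)
      · exact hc k
      · convert hsymm _ (hc k) using 2 <;> omega
    · intro hp
      have hb := hpt p hp
      by_cases h : p.2 ≤ 2 * m + 1
      · exact Or.inl (hlow p hp h)
      · obtain ⟨k, hk⟩ := hlow _ (hsymm p hp) (by dsimp only; omega)
        rw [Prod.mk.injEq] at hk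
        exact Or.inr ⟨k, Prod.ext (by dsimp only; omega) (by dsimp only; omega)⟩
  refine ⟨c, Finset.mem_filter.2 ⟨Fintype.mem_piFinset.2 fun k => ?_, ?_⟩, heq⟩
  · exact Finset.mem_range.2 (Nat.lt_succ_of_le (hle k))
  · rw [sum_single_foldCol_eq_iff hle, heq]
    exact hcol

theorem card_SDCF_odd (m : ℕ) : (SDCF (2 * m + 1)).card = (halfConfigs m).card :=
  (Finset.card_nbij (symPoints (2 * m + 1)) (fun _ hc => symPoints_mem_SDCF hc)
    (symPoints_injective _).injOn (fun _ hD => exists_symPoints_eq hD)).symm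

/-- `|SDC_{2n-1}| = P_n(1)` for all `n ≥ 1`. -/
theorem statement5 (n : ℕ) (hn : 1 ≤ n) :
    ((SDCF (2*n - 1)).card : ℚ) = (P n).eval 1 := by
  obtain ⟨m, rfl⟩ : ∃ m, n = m + 1 := ⟨n - 1, by omega⟩
  rw [show 2 * (m + 1) - 1 = 2 * m + 1 by omega, card_SDCF_odd, card_halfConfigs]

end SymDellac
end

section
/- For every integer n ≥ 2, |T_n^e| = (n(n+1)/2)·|T_{n−1}^e|, and consequently 2^n·|T_n^e| = (n+1)!·n! for every n ≥ 1. -/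
open scoped Classical

namespace SymDellac

/-- `T` is a configuration with `n` columns whose rows are indexed by `S`: each row of `S` has one
point, each column has two points, and every point `(j, i)` satisfies `j ≤ i`. -/
def IsRowConfig (n : ℕ) (S : Finset ℕ) (T : Finset (ℕ × ℕ)) : Prop :=
  (∀ p ∈ T, 1 ≤ p.1 ∧ p.1 ≤ n ∧ p.2 ∈ S ∧ p.1 ≤ p.2) ∧
  (∀ i ∈ S, (T.filter (fun p => p.2 = i)).card = 1) ∧
  (∀ j ∈ Finset.Icc 1 n, (T.filter (fun p => p.1 = j)).card = 2)

/-- The finite set of configurations with `n` columns and row set `S`. -/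
noncomputable def rowConfigs (n : ℕ) (S : Finset ℕ) : Finset (Finset (ℕ × ℕ)) :=
  ((Finset.Icc 1 n ×ˢ S).powerset).filter (IsRowConfig n S)

theorem mem_rowConfigs {n : ℕ} {S : Finset ℕ} {T : Finset (ℕ × ℕ)} :
    T ∈ rowConfigs n S ↔ IsRowConfig n S T := by
  simp only [rowConfigs, Finset.mem_filter, Finset.mem_powerset, and_iff_right_iff_imp]
  intro h p hp
  have := h.1 p hp
  simp only [Finset.mem_product, Finset.mem_Icc]
  tauto

theorem TneF_eq_rowConfigs (n : ℕ) : TneF n = rowConfigs n (Finset.Icc 1 (2 * n)) := by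
  have h : IsTne n = IsRowConfig n (Finset.Icc 1 (2 * n)) := by
    funext T
    simp only [IsTne, IsRowConfig, Finset.mem_Icc, and_assoc]
  simp only [TneF, rowConfigs, h]

/-- The rows occupied in column `j` of `T`. -/
def columnRows (j : ℕ) (T : Finset (ℕ × ℕ)) : Finset ℕ :=
  (T.filter (fun p => p.1 = j)).image Prod.snd

theorem mem_columnRows {j i : ℕ} {T : Finset (ℕ × ℕ)} :
    i ∈ columnRows j T ↔ (j, i) ∈ T := by
  simp [columnRows]

theorem card_columnRows (j : ℕ) (T : Finset (ℕ × ℕ)) :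
    (columnRows j T).card = (T.filter (fun p => p.1 = j)).card := by
  refine Finset.card_image_of_injOn ?_
  rintro ⟨a, b⟩ hp ⟨c, d⟩ hq h
  simp_all

theorem IsRowConfig.filter_ne_last {n : ℕ} {S : Finset ℕ} {T : Finset (ℕ × ℕ)}
    (hT : IsRowConfig (n + 1) S T) :
    IsRowConfig n (S \ columnRows (n + 1) T) (T.filter (fun p => p.1 ≠ n + 1)) := by
  obtain ⟨h1, h2, h3⟩ := hT
  refine ⟨?_, ?_, ?_⟩
  · rintro ⟨j, i⟩ hp
    obtain ⟨hp, hj⟩ := Finset.mem_filter.1 hp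
    obtain ⟨h4, h5, h6, h7⟩ := h1 _ hp
    refine ⟨h4, by simp only at *; omega, ?_, h7⟩
    refine Finset.mem_sdiff.2 ⟨h6, fun hc => hj ?_⟩
    obtain ⟨q, hq⟩ := Finset.card_eq_one.1 (h2 i h6)
    have ha : (j, i) ∈ T.filter (fun p => p.2 = i) := by simp [hp]
    have hb : (n + 1, i) ∈ T.filter (fun p => p.2 = i) := by simp [mem_columnRows.1 hc]
    rw [hq, Finset.mem_singleton] at ha hb
    exact congrArg Prod.fst (ha.trans hb.symm)
  · intro i hi
    obtain ⟨hi, hc⟩ := Finset.mem_sdiff.1 hi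
    refine (congrArg Finset.card ?_).trans (h2 i hi)
    ext ⟨a, b⟩
    simp only [Finset.mem_filter, mem_columnRows] at *
    refine ⟨fun h => ⟨h.1.1, h.2⟩, fun h => ⟨⟨h.1, ?_⟩, h.2⟩⟩
    rintro rfl
    exact hc (h.2 ▸ h.1)
  · intro j hj
    rw [Finset.mem_Icc] at hj
    rw [← h3 j (Finset.mem_Icc.2 ⟨hj.1, by omega⟩)]
    congr 1
    ext ⟨a, b⟩
    simp only [Finset.mem_filter]
    refine ⟨fun h => ⟨h.1.1, h.2⟩, fun h => ⟨⟨h.1, by omega⟩, h.2⟩⟩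

theorem columnRows_union {n : ℕ} {S A : Finset ℕ} {T : Finset (ℕ × ℕ)}
    (hT : IsRowConfig n S T) : columnRows (n + 1) (T ∪ {n + 1} ×ˢ A) = A := by
  ext i
  simp only [mem_columnRows, Finset.mem_union, Finset.mem_product, Finset.mem_singleton, true_and,
    or_iff_right_iff_imp]
  intro h
  have := (hT.1 _ h).2.1
  simp at this

theorem IsRowConfig.union_last {n : ℕ} {S A : Finset ℕ} {T : Finset (ℕ × ℕ)}
    (hA : A ∈ (S.filter (fun i => n + 1 ≤ i)).powersetCard 2) (hT : IsRowConfig n (S \ A) T) :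
    IsRowConfig (n + 1) S (T ∪ {n + 1} ×ˢ A) := by
  obtain ⟨hAS, hA2⟩ := Finset.mem_powersetCard.1 hA
  have hcol := columnRows_union (A := A) hT
  obtain ⟨h1, h2, h3⟩ := hT
  refine ⟨?_, ?_, ?_⟩
  · rintro ⟨j, i⟩ hp
    simp only [Finset.mem_union, Finset.mem_product, Finset.mem_singleton] at hp
    rcases hp with hp | ⟨rfl, hi⟩
    · obtain ⟨h4, h5, h6, h7⟩ := h1 _ hp
      exact ⟨h4, by omega, (Finset.mem_sdiff.1 h6).1, h7⟩
    · have := Finset.mem_filter.1 (hAS hi)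
      exact ⟨by simp, le_rfl, this.1, this.2⟩
  · intro i hi
    by_cases hiA : i ∈ A
    · rw [Finset.card_eq_one]
      refine ⟨(n + 1, i), ?_⟩
      ext ⟨a, b⟩
      simp only [Finset.mem_filter, Finset.mem_union, Finset.mem_product, Finset.mem_singleton,
        Prod.mk.injEq]
      constructor
      · rintro ⟨h | h, rfl⟩
        · exact absurd hiA (Finset.mem_sdiff.1 (h1 _ h).2.2.1).2
        · exact ⟨h.1, rfl⟩
      · rintro ⟨rfl, rfl⟩
        exact ⟨Or.inr ⟨rfl, hiA⟩, rfl⟩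
    · rw [← h2 i (Finset.mem_sdiff.2 ⟨hi, hiA⟩)]
      congr 1
      ext ⟨a, b⟩
      simp only [Finset.mem_filter, Finset.mem_union, Finset.mem_product, Finset.mem_singleton]
      grind
  · intro j hj
    rw [Finset.mem_Icc] at hj
    by_cases hjn : j = n + 1
    · rw [hjn, ← card_columnRows, hcol, hA2]
    · rw [← h3 j (Finset.mem_Icc.2 ⟨hj.1, by omega⟩)]
      congr 1
      ext ⟨a, b⟩
      simp only [Finset.mem_filter, Finset.mem_union, Finset.mem_product, Finset.mem_singleton]
      grind

theorem card_rowConfigs_fiber {n : ℕ} {S A : Finset ℕ}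
    (hA : A ∈ (S.filter (fun i => n + 1 ≤ i)).powersetCard 2) :
    ((rowConfigs (n + 1) S).filter (fun T => columnRows (n + 1) T = A)).card =
      (rowConfigs n (S \ A)).card := by
  refine Finset.card_nbij' (fun T => T.filter (fun p => p.1 ≠ n + 1))
    (fun T => T ∪ {n + 1} ×ˢ A) ?_ ?_ ?_ ?_
  · intro T hT
    simp only [Finset.mem_coe, Finset.mem_filter, mem_rowConfigs] at hT ⊢
    exact hT.2 ▸ hT.1.filter_ne_last
  · intro T hT
    simp only [Finset.mem_coe, Finset.mem_filter, mem_rowConfigs] at hT ⊢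
    exact ⟨hT.union_last hA, columnRows_union hT⟩
  · intro T hT
    obtain ⟨-, rfl⟩ := Finset.mem_filter.1 hT
    ext ⟨a, b⟩
    simp only [Finset.mem_filter, Finset.mem_union, Finset.mem_product, Finset.mem_singleton,
      mem_columnRows]
    grind
  · intro T hT
    have h1 := (mem_rowConfigs.1 hT).1
    ext ⟨a, b⟩
    simp only [Finset.mem_filter, Finset.mem_union, Finset.mem_product, Finset.mem_singleton]
    grind

theorem card_rowConfigs_succ (n : ℕ) (S : Finset ℕ) :
    (rowConfigs (n + 1) S).card =
      ∑ A ∈ (S.filter (fun i => n + 1 ≤ i)).powersetCard 2, (rowConfigs n (S \ A)).card := by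
  rw [Finset.card_eq_sum_card_fiberwise (f := columnRows (n + 1))
    (t := (S.filter (fun i => n + 1 ≤ i)).powersetCard 2)]
  · exact Finset.sum_congr rfl fun A hA => card_rowConfigs_fiber hA
  · intro T hT
    obtain ⟨h1, -, h3⟩ := mem_rowConfigs.1 hT
    refine Finset.mem_coe.2 (Finset.mem_powersetCard.2 ⟨fun i hi => ?_, ?_⟩)
    · have := h1 _ (mem_columnRows.1 hi)
      exact Finset.mem_filter.2 this.2.2
    · rw [card_columnRows]
      exact h3 _ (by simp)

theorem card_rowConfigs {n : ℕ} {S : Finset ℕ} (hpos : 0 ∉ S)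
    (hsub : Finset.Ico 1 n ⊆ S) (hcard : S.card = 2 * n) :
    (rowConfigs n S).card = ∏ j ∈ Finset.range n, (j + 2).choose 2 := by
  induction n generalizing S with
  | zero =>
    obtain rfl : S = ∅ := by simpa using hcard
    rw [Finset.prod_range_zero, Finset.card_eq_one]
    refine ⟨∅, ?_⟩
    ext T
    rw [mem_rowConfigs, Finset.mem_singleton]
    constructor
    · exact fun h => Finset.eq_empty_of_forall_notMem fun p hp => by simpa using (h.1 p hp).2.2.1
    · rintro rfl
      simp [IsRowConfig]
  | succ n ih =>
    have hlow : S.filter (fun i => ¬ n + 1 ≤ i) = Finset.Ico 1 (n + 1) := by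
      ext i
      simp only [Finset.mem_filter, Finset.mem_Ico]
      refine ⟨fun h => ⟨Nat.one_le_iff_ne_zero.2 fun h0 => hpos (h0 ▸ h.1), by omega⟩,
        fun h => ⟨hsub (Finset.mem_Ico.2 h), by omega⟩⟩
    have hhigh : (S.filter (fun i => n + 1 ≤ i)).card = n + 2 := by
      have := Finset.card_filter_add_card_filter_not (s := S) (fun i => n + 1 ≤ i)
      rw [hlow, Nat.card_Ico] at this
      omega
    rw [card_rowConfigs_succ, Finset.sum_congr rfl (g := fun _ =>
      ∏ j ∈ Finset.range n, (j + 2).choose 2), Finset.sum_const, Finset.card_powersetCard, hhigh,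
      Finset.prod_range_succ, smul_eq_mul, mul_comm]
    intro A hA
    obtain ⟨hAS, hA2⟩ := Finset.mem_powersetCard.1 hA
    refine ih (fun h => hpos (Finset.mem_sdiff.1 h).1) (fun i hi => ?_) ?_
    · rw [Finset.mem_Ico] at hi
      refine Finset.mem_sdiff.2 ⟨hsub (Finset.mem_Ico.2 ⟨hi.1, by omega⟩), fun h => ?_⟩
      have := (Finset.mem_filter.1 (hAS h)).2
      omega
    · rw [Finset.card_sdiff_of_subset (hAS.trans (Finset.filter_subset _ _)), hcard, hA2]
      omega

theorem card_TneF (n : ℕ) : (TneF n).card = ∏ j ∈ Finset.range n, (j + 2).choose 2 := by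
  rw [TneF_eq_rowConfigs]
  refine card_rowConfigs (by simp) (fun i hi => ?_) (by simp)
  rw [Finset.mem_Ico] at hi
  exact Finset.mem_Icc.2 ⟨hi.1, by omega⟩

theorem card_TneF_succ (n : ℕ) :
    (TneF (n + 1)).card = (n + 2).choose 2 * (TneF n).card := by
  rw [card_TneF, card_TneF, Finset.prod_range_succ, mul_comm]

/-- `|T_n^e| = (n(n+1)/2) |T_{n-1}^e|` for `n ≥ 2`, and consequently
`2^n |T_n^e| = (n+1)! n!` for `n ≥ 1`. -/
theorem statement6 :
    (∀ n : ℕ, 2 ≤ n → (TneF n).card = (n * (n+1) / 2) * (TneF (n-1)).card) ∧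
    (∀ n : ℕ, 1 ≤ n →
      2 ^ n * (TneF n).card = Nat.factorial (n+1) * Nat.factorial n) := by
  refine ⟨fun n hn => ?_, fun n hn => ?_⟩
  · obtain ⟨m, rfl⟩ := Nat.exists_eq_add_of_le' (Nat.one_le_of_lt hn)
    rw [card_TneF_succ, Nat.choose_two_right, mul_comm (m + 2)]
    rfl
  · clear hn
    induction n with
    | zero => simp [card_TneF]
    | succ m ih =>
      have h : 2 * (m + 2).choose 2 = (m + 2) * (m + 1) := by
        rw [Nat.choose_two_right, mul_comm 2, Nat.div_mul_cancel (Nat.even_mul_pred_self _).two_dvd]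
        rfl
      rw [card_TneF_succ, Nat.factorial_succ (m + 1)]
      nth_rewrite 2 [Nat.factorial_succ m]
      calc 2 ^ (m + 1) * ((m + 2).choose 2 * (TneF m).card)
          = 2 * (m + 2).choose 2 * (2 ^ m * (TneF m).card) := by ring
        _ = _ := by rw [h, ih]; ring

end SymDellac
end
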